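/- arXiv:1506.08547 — 3 statements merged into one kernel-verified Lean document; each statement's English description precedes it below -/
import Mathlib

section
/- Assume (ρ,∼) is strongly commutative, (F,∼) is a potential causality graph, λ satisfies condition (A), and (λ,μ,θ) satisfy the cluster-expansion condition. Then for every deterministic strategy Λ and every integer t ≥ 0, ∑_{τ∈Bad(t)} p(τ) ≤ γ^init · (∑_{R ∈ Ind(F)} μ(R)) · θ^t, where μ(R) = ∏_{f∈R} μ_f. -/
open scoped Classical

noncomputable section

namespace LLLFormal

/-- A walk: an initial state together with a list of (flaw, next-state) steps. -/
structure Walk (Ω F : Type*) where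
  start : Ω
  steps : List (F × Ω)

variable {Ω F : Type*}

/-- Validity of a list of steps from a given state, w.r.t. a step relation. -/
def ValidFrom (step : F → Ω → Ω → Prop) : Ω → List (F × Ω) → Prop
  | _, [] => True
  | σ, (f, σ') :: rest => step f σ σ' ∧ ValidFrom step σ' rest

/-- The state reached after performing the steps `l` starting from `σ`. -/
def endOf (σ : Ω) (l : List (F × Ω)) : Ω := (l.map Prod.snd).getLastD σ

/-- `τ` is a (valid) walk w.r.t. the step relation `step`. -/
def Walk.Valid (step : F → Ω → Ω → Prop) (τ : Walk Ω F) : Prop := ValidFrom step τ.start τ.steps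

/-- The flaw word of a walk. -/
def Walk.word (τ : Walk Ω F) : List F := τ.steps.map Prod.fst

/-- The final state of a walk. -/
def Walk.final (τ : Walk Ω F) : Ω := endOf τ.start τ.steps

/-- The length of a walk. -/
def Walk.len (τ : Walk Ω F) : ℕ := τ.steps.length

/-- Product of the transition probabilities along a list of steps. -/
def prodRho (ρ : F → Ω → Ω → ℝ) : Ω → List (F × Ω) → ℝ
  | _, [] => 1
  | σ, (f, σ') :: rest => ρ f σ σ' * prodRho ρ σ' rest

/-- The weight `p(τ)` of a walk. -/
def Walk.wt (ωinit : Ω → ℝ) (ρ : F → Ω → Ω → ℝ) (τ : Walk Ω F) : ℝ :=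
  ωinit τ.start * prodRho ρ τ.start τ.steps

/-- `λ_W = ∏_i λ_{w_i}`. -/
def wordWt (lam : F → ℝ) (W : List F) : ℝ := (W.map lam).prod

/-- The data of the objects, flaws, actions and resampling oracles:
`mem f σ` means `σ ∈ f`; `Act f σ` is the action set `A(f,σ)`;
`ρ f σ σ'` is the probability `ρ(σ'|f,σ)`, whose support is exactly `A(f,σ)`. -/
structure Setup (Ω F : Type*) [Fintype Ω] where
  mem : F → Ω → Prop
  flaw_nonempty : ∀ f, ∃ σ, mem f σ
  Act : F → Ω → Set Ω
  act_nonempty : ∀ f σ, mem f σ → (Act f σ).Nonempty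
  ρ : F → Ω → Ω → ℝ
  ρ_nonneg : ∀ f σ σ', 0 ≤ ρ f σ σ'
  ρ_support : ∀ f σ, mem f σ → ∀ σ', (0 < ρ f σ σ' ↔ σ' ∈ Act f σ)
  ρ_total : ∀ f σ, mem f σ → ∑ σ' : Ω, ρ f σ σ' = 1

variable [Fintype Ω]

/-- A valid step `σ →^f σ'`. -/
def Setup.step (S : Setup Ω F) (f : F) (σ σ' : Ω) : Prop := S.mem f σ ∧ σ' ∈ S.Act f σ

/-- A probability distribution on `Ω`. -/
def IsProb (ω : Ω → ℝ) : Prop := (∀ σ, 0 ≤ ω σ) ∧ ∑ σ : Ω, ω σ = 1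

/-- A probability distribution on `Ω` with full support. -/
def IsPosProb (ω : Ω → ℝ) : Prop := (∀ σ, 0 < ω σ) ∧ ∑ σ : Ω, ω σ = 1

/-- `γ^init = max_{σ∈Ω} ωinit σ / ω σ`. -/
def gammaInit [Nonempty Ω] (ωinit ω : Ω → ℝ) : ℝ :=
  Finset.univ.sup' Finset.univ_nonempty fun σ => ωinit σ / ω σ

/-- Condition (A): `λ_f ≥ ∑_{σ ∈ f : σ' ∈ A(f,σ)} ρ(σ'|f,σ) ω(σ)/ω(σ')`. -/
def CondA (S : Setup Ω F) (ω : Ω → ℝ) (lam : F → ℝ) : Prop :=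
  ∀ (f : F) (σ' : Ω),
    lam f ≥ ∑ σ : Ω, if S.mem f σ ∧ σ' ∈ S.Act f σ then S.ρ f σ σ' * ω σ / ω σ' else 0

/-- `(F, ∼)` is a potential causality graph:
for every valid step `σ →^f σ'`, `F_{σ'} ⊆ (F_σ − {f}) ∪ Γ(f)`. -/
def Causality (S : Setup Ω F) (sim : F → F → Prop) : Prop :=
  ∀ f σ σ', S.step f σ σ' → ∀ g, S.mem g σ' → (S.mem g σ ∧ g ≠ f) ∨ sim f g

/-- A finite set of flaws is independent. -/
def IndepF (sim : F → F → Prop) (I : Finset F) : Prop :=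
  ∀ f ∈ I, ∀ g ∈ I, f ≠ g → ¬ sim f g

/-- `B` is a partition of the word `W` into consecutive nonempty blocks of distinct,
pairwise non-neighbouring flaws, with each block contained in `Γ⁺` of the previous one. -/
def StablePartition (sim : F → F → Prop) (B : List (List F)) (W : List F) : Prop :=
  W = B.flatten ∧
  (∀ b ∈ B, b ≠ [] ∧ b.Nodup ∧ b.Pairwise fun f g => ¬ sim f g) ∧
  B.Chain' fun b₁ b₂ => ∀ g ∈ b₂, ∃ f ∈ b₁, f = g ∨ sim f g

/-- A stable word. -/
def StableWord (sim : F → F → Prop) (W : List F) : Prop := ∃ B, StablePartition sim B W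

/-- A stable partition whose blocks are listed in strictly increasing order. -/
def PiStablePartition [LinearOrder F] (sim : F → F → Prop) (B : List (List F))
    (W : List F) : Prop :=
  StablePartition sim B W ∧ ∀ b ∈ B, b.Chain' (· < ·)

/-- A π-stable word. -/
def PiStableWord [LinearOrder F] (sim : F → F → Prop) (W : List F) : Prop :=
  ∃ B, PiStablePartition sim B W

/-- A deterministic strategy: it assigns to every walk whose final state is flawed
a flaw present in the final state. -/
def IsStrategy (S : Setup Ω F) (Λ : Walk Ω F → F) : Prop :=
  ∀ τ : Walk Ω F, Walk.Valid S.step τ → (∃ f, S.mem f (Walk.final τ)) →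
    S.mem (Λ τ) (Walk.final τ)

/-- A walk follows the strategy `Λ`. -/
def Follows (Λ : Walk Ω F → F) (τ : Walk Ω F) : Prop :=
  ∀ (i : ℕ) (h : i < τ.steps.length),
    (τ.steps.get ⟨i, h⟩).1 = Λ ⟨τ.start, τ.steps.take i⟩

/-- The set `Bad(t)` of bad `t`-trajectories. -/
def Bad (S : Setup Ω F) (Λ : Walk Ω F → F) (ωinit : Ω → ℝ) (t : ℕ) : Set (Walk Ω F) :=
  {τ | Walk.Valid S.step τ ∧ Walk.len τ = t ∧ Follows Λ τ ∧ 0 < ωinit τ.start}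

/-- The cluster-expansion condition:
`(λ_f/μ_f) ∑_{S ∈ Ind(Γ(f))} μ(S) ≤ θ` for every flaw `f`. -/
def ClusterCond [Fintype F] (sim : F → F → Prop) (lam μ : F → ℝ) (θ : ℝ) : Prop :=
  ∀ f : F,
    lam f / μ f *
      ∑ I ∈ Finset.univ.filter (fun I : Finset F => (∀ g ∈ I, sim f g) ∧ IndepF sim I),
        ∏ g ∈ I, μ g ≤ θ

/-- `τ` is a prefix of `τ'`. -/
def Walk.IsPrefix (τ τ' : Walk Ω F) : Prop := τ.start = τ'.start ∧ τ.steps <+: τ'.steps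

/-- A valid set of walks: all walks follow one common deterministic strategy,
and no walk is a proper prefix of another one. -/
def ValidSet (S : Setup Ω F) (X : Set (Walk Ω F)) : Prop :=
  (∀ τ ∈ X, Walk.Valid S.step τ) ∧
  (∃ Λ : Walk Ω F → F, IsStrategy S Λ ∧ ∀ τ ∈ X, Follows Λ τ) ∧
  ∀ τ ∈ X, ∀ τ' ∈ X, Walk.IsPrefix τ τ' → τ = τ'

/-- Atomicity of the resampling oracles. -/
def Atomic (S : Setup Ω F) : Prop :=
  ∀ f σ' σ₁ σ₂, S.step f σ₁ σ' → S.step f σ₂ σ' → σ₁ = σ₂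

/-- The map `swap` sends every swappable pair of steps to a valid pair of steps. -/
def SwapValid (S : Setup Ω F) (sim : F → F → Prop) (swap : Ω → F → Ω → F → Ω → Ω) : Prop :=
  ∀ σ₁ f σ₂ g σ₃, S.step f σ₁ σ₂ → S.step g σ₂ σ₃ → ¬ sim f g →
    S.step g σ₁ (swap σ₁ f σ₂ g σ₃) ∧ S.step f (swap σ₁ f σ₂ g σ₃) σ₃

/-- The map `swap` is injective (as a map of two-step walks). -/
def SwapInj (S : Setup Ω F) (sim : F → F → Prop) (swap : Ω → F → Ω → F → Ω → Ω) : Prop :=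
  ∀ σ₁ f σ₂ τ₂ g σ₃, S.step f σ₁ σ₂ → S.step g σ₂ σ₃ → S.step f σ₁ τ₂ → S.step g τ₂ σ₃ →
    ¬ sim f g → swap σ₁ f σ₂ g σ₃ = swap σ₁ f τ₂ g σ₃ → σ₂ = τ₂

/-- The map `swap` preserves the product of the two transition probabilities. -/
def SwapProb (S : Setup Ω F) (sim : F → F → Prop) (swap : Ω → F → Ω → F → Ω → Ω) : Prop :=
  ∀ σ₁ f σ₂ g σ₃, S.step f σ₁ σ₂ → S.step g σ₂ σ₃ → ¬ sim f g →
    S.ρ f σ₁ σ₂ * S.ρ g σ₂ σ₃ =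
      S.ρ g σ₁ (swap σ₁ f σ₂ g σ₃) * S.ρ f (swap σ₁ f σ₂ g σ₃) σ₃

/-- `(ρ, ∼)` is weakly commutative. -/
def WeakComm (S : Setup Ω F) (sim : F → F → Prop) : Prop :=
  ∃ swap, SwapValid S sim swap ∧ SwapInj S sim swap

/-- `(ρ, ∼)` is strongly commutative. -/
def StrongComm (S : Setup Ω F) (sim : F → F → Prop) : Prop :=
  ∃ swap, SwapValid S sim swap ∧ SwapInj S sim swap ∧ SwapProb S sim swap

/-- One valid swap transforming the walk `τ` into the walk `τ'`. -/
def SwapStep (S : Setup Ω F) (sim : F → F → Prop) (swap : Ω → F → Ω → F → Ω → Ω)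
    (τ τ' : Walk Ω F) : Prop :=
  ∃ (A B : List (F × Ω)) (f g : F) (σ₂ σ₃ : Ω),
    f ≠ g ∧ ¬ sim f g ∧
    S.step f (endOf τ.start A) σ₂ ∧ S.step g σ₂ σ₃ ∧
    τ.steps = A ++ (f, σ₂) :: (g, σ₃) :: B ∧
    τ' = ⟨τ.start, A ++ (g, swap (endOf τ.start A) f σ₂ g σ₃) :: (f, σ₃) :: B⟩

/-- `U` is a chain of the walk `τ`. -/
def IsChainOf (sim : F → F → Prop) (U : List F) (τ : Walk Ω F) : Prop :=
  U.Sublist (Walk.word τ) ∧ U.Chain' fun a b => a = b ∨ sim a b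

/-- The longest prefix of `W` ending with `f` (empty if `f` does not occur in `W`). -/
def prefEnd (f : F) (W : List F) : List F :=
  (W.reverse.dropWhile fun x => decide (x ≠ f)).reverse

/-- `W^f_τ` for `f ∈ F ∪ {∅}`. -/
def prefOpt (fo : Option F) (W : List F) : List F :=
  match fo with
  | none => W
  | some f => prefEnd f W

/-- `g ∈ Γ⁺(I)` for a list `I` of flaws. -/
def GammaPlusL (sim : F → F → Prop) (I : List F) (g : F) : Prop := ∃ f ∈ I, f = g ∨ sim f g

/-- The steps of one round, starting at state `σ` with already-addressed flaws `I`: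
each addressed flaw `f` satisfies `f ∈ F_σ − Γ⁺(I)` and the step is valid. -/
def RoundFrom (S : Setup Ω F) (sim : F → F → Prop) : Ω → List F → List (F × Ω) → Prop
  | _, _, [] => True
  | σ, I, (f, σ') :: rest =>
      S.mem f σ ∧ ¬ GammaPlusL sim I f ∧ σ' ∈ S.Act f σ ∧
      RoundFrom S sim σ' (I ++ [f]) rest

/-- Like `RoundFrom`, but the addressed flaw is moreover the `≼`-least of `F_σ − Γ⁺(I)`. -/
def RoundFromPi [LinearOrder F] (S : Setup Ω F) (sim : F → F → Prop) :
    Ω → List F → List (F × Ω) → Prop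
  | _, _, [] => True
  | σ, I, (f, σ') :: rest =>
      S.mem f σ ∧ ¬ GammaPlusL sim I f ∧
      (∀ g, S.mem g σ → ¬ GammaPlusL sim I g → f ≤ g) ∧
      σ' ∈ S.Act f σ ∧ RoundFromPi S sim σ' (I ++ [f]) rest

/-- A walk grouped into rounds: each round is valid, and at the final state of every
round except possibly the last one, `F_σ − Γ⁺(I_r) = ∅`. -/
def RoundsFrom (S : Setup Ω F) (sim : F → F → Prop) : Ω → List (List (F × Ω)) → Prop
  | _, [] => True
  | σ, b :: rest =>
      RoundFrom S sim σ [] b ∧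
      (rest = [] ∨
        ((∀ g, S.mem g (endOf σ b) → GammaPlusL sim (b.map Prod.fst) g) ∧
          RoundsFrom S sim (endOf σ b) rest))

/-- Like `RoundsFrom`, with the `≼`-least flaw selection rule. -/
def RoundsFromPi [LinearOrder F] (S : Setup Ω F) (sim : F → F → Prop) :
    Ω → List (List (F × Ω)) → Prop
  | _, [] => True
  | σ, b :: rest =>
      RoundFromPi S sim σ [] b ∧
      (rest = [] ∨
        ((∀ g, S.mem g (endOf σ b) → GammaPlusL sim (b.map Prod.fst) g) ∧
          RoundsFromPi S sim (endOf σ b) rest))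

/-- The family `Ind^init = ∪_{σ : ωinit σ > 0} Ind(F_σ)`. -/
def indInitSets [Fintype F] (S : Setup Ω F) (sim : F → F → Prop) (ωinit : Ω → ℝ) :
    Finset (Finset F) :=
  Finset.univ.filter fun R => IndepF sim R ∧ ∃ σ, 0 < ωinit σ ∧ ∀ f ∈ R, S.mem f σ

/-- `λ_φ` for a sequence of sets of flaws. -/
def seqWt (lam : F → ℝ) (φ : List (Finset F)) : ℝ := (φ.map fun I => ∏ f ∈ I, lam f).prod

/-- `|φ| = ∑_r |I_r|`. -/
def seqSize (φ : List (Finset F)) : ℕ := (φ.map Finset.card).sum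

/-- A strongly stable sequence. -/
def StronglyStableSeq (sim : F → F → Prop) (φ : List (Finset F)) : Prop :=
  φ ≠ [] ∧ (∀ I ∈ φ, IndepF sim I) ∧
  φ.Chain' (fun I J => ∀ g ∈ J, ∃ f ∈ I, sim f g) ∧
  ∀ I ∈ φ.tail, I ≠ ∅

/-- Membership in `Stab(R,S,t,ℓ)`. -/
def StabRSTL (sim : F → F → Prop) (R S : Finset F) (t ℓ : ℕ) (φ : List (Finset F)) : Prop :=
  φ.head? = some R ∧ φ.length ≤ ℓ ∧ t ≤ seqSize φ ∧
  ((φ.length = 1 ∧ S = ∅) ∨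
    (2 ≤ φ.length ∧ S = φ.tail.headI.filter (fun g => ¬ ∃ f ∈ R, sim f g) ∧
      StronglyStableSeq sim φ.tail))

/-- One valid swap on words. -/
def WordSwap (sim : F → F → Prop) (W W' : List F) : Prop :=
  ∃ (A B : List F) (f g : F), f ≠ g ∧ ¬ sim f g ∧ W = A ++ f :: g :: B ∧ W' = A ++ g :: f :: B

end LLLFormal

namespace LLLFormal

section Matrices

variable {Ω F : Type*} [Fintype Ω]

/-- The sub-stochastic transition matrix of a flaw. -/
def flawMatrix (S : Setup Ω F) (f : F) : Matrix Ω Ω ℝ :=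
  Matrix.of fun σ σ' => if S.step f σ σ' then S.ρ f σ σ' else 0

/-- The product of the transition matrices of the flaws of a finite set. -/
def blockMatrix (S : Setup Ω F) (I : Finset F) : Matrix Ω Ω ℝ :=
  (I.toList.map (flawMatrix S)).prod

/-- The matrix of a sequence of blocks, the head of the list being addressed last. -/
def seqMatrix (S : Setup Ω F) : List (Finset F) → Matrix Ω Ω ℝ
  | [] => 1
  | I :: r => seqMatrix S r * blockMatrix S I

/-- `f` is related to some flaw in some block. -/
def Touches (sim : F → F → Prop) (f : F) (φ : List (Finset F)) : Prop :=
  ∃ J ∈ φ, ∃ g ∈ J, sim f g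

/-- Insert a flaw addressed before all blocks of `φ`, moving it as late in time as possible. -/
def insertFlaw (sim : F → F → Prop) (f : F) : List (Finset F) → List (Finset F)
  | [] => [{f}]
  | I :: r => if Touches sim f (I :: r) then I :: insertFlaw sim f r else insert f I :: r

/-- Normal forms: nonempty independent blocks, each contained in the neighbourhood of the
previous one. -/
def NormalSeq (sim : F → F → Prop) : List (Finset F) → Prop
  | [] => True
  | I :: r => IndepF sim I ∧ I ≠ ∅ ∧ (∀ J ∈ r.head?, ∀ g ∈ J, ∃ f ∈ I, sim f g) ∧
      NormalSeq sim r

theorem flawMatrix_nonneg (S : Setup Ω F) (f : F) (σ σ' : Ω) : 0 ≤ flawMatrix S f σ σ' := by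
  simp only [flawMatrix, Matrix.of_apply]
  split_ifs
  · exact S.ρ_nonneg _ _ _
  · exact le_rfl

theorem flawMatrix_mul_le (S : Setup Ω F) (sim : F → F → Prop)
    (hsc : StrongComm S sim) {f g : F} (hfg : ¬ sim f g) (σ₁ σ₃ : Ω) :
    (flawMatrix S f * flawMatrix S g) σ₁ σ₃ ≤ (flawMatrix S g * flawMatrix S f) σ₁ σ₃ := by
  obtain ⟨swap, hval, hinj, hprob⟩ := hsc
  simp only [Matrix.mul_apply]
  have hfilter : ∑ σ₂, flawMatrix S f σ₁ σ₂ * flawMatrix S g σ₂ σ₃ =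
      ∑ σ₂ ∈ Finset.univ.filter (fun σ₂ => S.step f σ₁ σ₂ ∧ S.step g σ₂ σ₃),
        flawMatrix S f σ₁ σ₂ * flawMatrix S g σ₂ σ₃ := by
    symm
    apply Finset.sum_subset (Finset.subset_univ _)
    intro σ₂ _ h
    simp only [Finset.mem_filter, Finset.mem_univ, true_and, not_and] at h
    simp only [flawMatrix, Matrix.of_apply]
    by_cases h1 : S.step f σ₁ σ₂
    · simp [h h1]
    · simp [h1]
  rw [hfilter]
  have himage : ∑ σ₂ ∈ Finset.univ.filter (fun σ₂ => S.step f σ₁ σ₂ ∧ S.step g σ₂ σ₃),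
        flawMatrix S f σ₁ σ₂ * flawMatrix S g σ₂ σ₃ =
      ∑ τ ∈ (Finset.univ.filter (fun σ₂ => S.step f σ₁ σ₂ ∧ S.step g σ₂ σ₃)).image
        (fun σ₂ => swap σ₁ f σ₂ g σ₃), flawMatrix S g σ₁ τ * flawMatrix S f τ σ₃ := by
    rw [Finset.sum_image]
    · refine Finset.sum_congr rfl fun σ₂ h => ?_
      obtain ⟨h1, h2⟩ := (Finset.mem_filter.mp h).2
      obtain ⟨h3, h4⟩ := hval _ _ _ _ _ h1 h2 hfg
      simpa [flawMatrix, h1, h2, h3, h4] using hprob _ _ _ _ _ h1 h2 hfg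
    · intro a ha b hb hab
      obtain ⟨h1, h2⟩ := (Finset.mem_filter.mp ha).2
      obtain ⟨h3, h4⟩ := (Finset.mem_filter.mp hb).2
      exact hinj _ _ _ _ _ _ h1 h2 h3 h4 hfg hab
  rw [himage]
  exact Finset.sum_le_sum_of_subset_of_nonneg (Finset.subset_univ _) fun _ _ _ =>
    mul_nonneg (flawMatrix_nonneg _ _ _ _) (flawMatrix_nonneg _ _ _ _)

theorem flawMatrix_commute (S : Setup Ω F) (sim : F → F → Prop) (hsym : Symmetric sim)
    (hsc : StrongComm S sim) {f g : F} (hfg : ¬ sim f g) :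
    Commute (flawMatrix S f) (flawMatrix S g) := by
  ext σ σ'
  exact le_antisymm (flawMatrix_mul_le S sim hsc hfg σ σ')
    (flawMatrix_mul_le S sim hsc (fun h => hfg (hsym h)) σ σ')

theorem flawMatrix_mul_self (S : Setup Ω F) (sim : F → F → Prop) (hcaus : Causality S sim)
    {f : F} (hf : ¬ sim f f) : flawMatrix S f * flawMatrix S f = 0 := by
  ext σ σ'
  rw [Matrix.mul_apply]
  refine Finset.sum_eq_zero fun τ _ => ?_
  simp only [flawMatrix, Matrix.of_apply]
  by_cases h1 : S.step f σ τ
  · have h2 : ¬ S.step f τ σ' := fun h2 => by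
      rcases hcaus f σ τ h1 f h2.1 with h | h
      · exact h.2 rfl
      · exact hf h
    simp [h2]
  · simp [h1]

theorem blockMatrix_insert (S : Setup Ω F) (sim : F → F → Prop) (hsym : Symmetric sim)
    (hsc : StrongComm S sim) {f : F} {I : Finset F} (hI : IndepF sim (insert f I))
    (hf : f ∉ I) : blockMatrix S (insert f I) = flawMatrix S f * blockMatrix S I := by
  rw [blockMatrix, blockMatrix, ← List.prod_cons, ← List.map_cons]
  refine List.Perm.prod_eq' ((Finset.toList_insert hf).map _) ?_
  rw [List.pairwise_map]
  refine List.Pairwise.imp_of_mem ?_ (Finset.nodup_toList _)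
  intro a b ha hb hab
  exact flawMatrix_commute S sim hsym hsc (hI a (by simpa using ha) b (by simpa using hb) hab)

theorem commute_blockMatrix (S : Setup Ω F) (sim : F → F → Prop) (hsym : Symmetric sim)
    (hsc : StrongComm S sim) {f : F} {I : Finset F} (hI : ∀ g ∈ I, ¬ sim f g) :
    Commute (flawMatrix S f) (blockMatrix S I) := by
  apply Commute.list_prod_right
  intro x hx
  obtain ⟨g, hg, rfl⟩ := List.mem_map.mp hx
  exact flawMatrix_commute S sim hsym hsc (hI g (by simpa using hg))

theorem commute_seqMatrix (S : Setup Ω F) (sim : F → F → Prop) (hsym : Symmetric sim)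
    (hsc : StrongComm S sim) {f : F} (φ : List (Finset F)) (hφ : ¬ Touches sim f φ) :
    Commute (flawMatrix S f) (seqMatrix S φ) := by
  induction φ with
  | nil => exact Commute.one_right _
  | cons I r ih =>
    refine Commute.mul_right (ih ?_) (commute_blockMatrix S sim hsym hsc ?_)
    · rintro ⟨J, hJ, h⟩
      exact hφ ⟨J, List.mem_cons_of_mem _ hJ, h⟩
    · intro g hg h
      exact hφ ⟨I, List.mem_cons_self, g, hg, h⟩

theorem indepF_insert {sim : F → F → Prop} (hsym : Symmetric sim) {f : F} {I : Finset F}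
    (hI : IndepF sim I) (hf : ∀ g ∈ I, ¬ sim f g) : IndepF sim (insert f I) := by
  intro a ha b hb hab
  rcases Finset.mem_insert.mp ha with hae | haI <;> rcases Finset.mem_insert.mp hb with hbe | hbI
  · exact absurd (hae.trans hbe.symm) hab
  · exact hae ▸ hf b hbI
  · exact fun h => hf a haI (hsym (hbe ▸ h))
  · exact hI a haI b hbI hab

theorem indepF_mono {sim : F → F → Prop} {I J : Finset F} (h : I ⊆ J) (hJ : IndepF sim J) :
    IndepF sim I := fun a ha b hb => hJ a (h ha) b (h hb)

theorem notMem_of_mul_ne_zero (S : Setup Ω F) (sim : F → F → Prop) (hsym : Symmetric sim)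
    (hcaus : Causality S sim) (hsc : StrongComm S sim) {f : F} {I : Finset F}
    {r : List (Finset F)} (hI : IndepF sim I) (hφ : ¬ Touches sim f (I :: r))
    (h0 : flawMatrix S f * seqMatrix S (I :: r) ≠ 0) : f ∉ I := by
  intro hf
  apply h0
  have hr : ¬ Touches sim f r := fun ⟨J, hJ, h⟩ => hφ ⟨J, List.mem_cons_of_mem _ hJ, h⟩
  have hff : ¬ sim f f := fun h => hφ ⟨I, List.mem_cons_self, f, hf, h⟩
  have hb : blockMatrix S I = flawMatrix S f * blockMatrix S (I.erase f) := by
    conv_lhs => rw [← Finset.insert_erase hf]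
    apply blockMatrix_insert S sim hsym hsc _ (Finset.notMem_erase f I)
    rwa [Finset.insert_erase hf]
  rw [seqMatrix, ← mul_assoc, (commute_seqMatrix S sim hsym hsc r hr).eq, hb, mul_assoc,
    ← mul_assoc (flawMatrix S f), flawMatrix_mul_self S sim hcaus hff, zero_mul, mul_zero]

theorem tail_mul_ne_zero {S : Setup Ω F} {f : F} {I : Finset F} {r : List (Finset F)}
    (h0 : flawMatrix S f * seqMatrix S (I :: r) ≠ 0) : flawMatrix S f * seqMatrix S r ≠ 0 := by
  intro h
  apply h0
  rw [seqMatrix, ← mul_assoc, h, zero_mul]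

theorem seqMatrix_insertFlaw (S : Setup Ω F) (sim : F → F → Prop) (hsym : Symmetric sim)
    (hcaus : Causality S sim) (hsc : StrongComm S sim) {f : F} (φ : List (Finset F))
    (hφ : NormalSeq sim φ) (h0 : flawMatrix S f * seqMatrix S φ ≠ 0) :
    seqMatrix S (insertFlaw sim f φ) = flawMatrix S f * seqMatrix S φ := by
  induction φ with
  | nil => simp [insertFlaw, seqMatrix, blockMatrix]
  | cons I r ih =>
    by_cases ht : Touches sim f (I :: r)
    · rw [insertFlaw, if_pos ht, seqMatrix, ih hφ.2.2.2 (tail_mul_ne_zero h0), seqMatrix,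
        mul_assoc]
    · have hf := notMem_of_mul_ne_zero S sim hsym hcaus hsc hφ.1 ht h0
      have hr : ¬ Touches sim f r := fun ⟨J, hJ, h⟩ => ht ⟨J, List.mem_cons_of_mem _ hJ, h⟩
      rw [insertFlaw, if_neg ht, seqMatrix, seqMatrix, blockMatrix_insert S sim hsym hsc
        (indepF_insert hsym hφ.1 fun g hg h => ht ⟨I, List.mem_cons_self, g, hg, h⟩) hf,
        ← mul_assoc, ← mul_assoc, (commute_seqMatrix S sim hsym hsc r hr).eq]

theorem seqSize_insertFlaw (S : Setup Ω F) (sim : F → F → Prop) (hsym : Symmetric sim)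
    (hcaus : Causality S sim) (hsc : StrongComm S sim) {f : F} (φ : List (Finset F))
    (hφ : NormalSeq sim φ) (h0 : flawMatrix S f * seqMatrix S φ ≠ 0) :
    seqSize (insertFlaw sim f φ) = seqSize φ + 1 := by
  induction φ with
  | nil => simp [insertFlaw, seqSize]
  | cons I r ih =>
    by_cases ht : Touches sim f (I :: r)
    · have := ih hφ.2.2.2 (tail_mul_ne_zero h0)
      simp only [seqSize] at this
      simp only [insertFlaw, if_pos ht, seqSize, List.map_cons, List.sum_cons, this]
      omega
    · have hf := notMem_of_mul_ne_zero S sim hsym hcaus hsc hφ.1 ht h0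
      simp only [insertFlaw, if_neg ht, seqSize, List.map_cons, List.sum_cons,
        Finset.card_insert_of_notMem hf]
      omega

theorem normalSeq_insertFlaw (sim : F → F → Prop) (hsym : Symmetric sim) {f : F}
    (φ : List (Finset F)) (hφ : NormalSeq sim φ) : NormalSeq sim (insertFlaw sim f φ) := by
  induction φ with
  | nil => simp [insertFlaw, NormalSeq, IndepF]
  | cons I r ih =>
    by_cases ht : Touches sim f (I :: r)
    · rw [insertFlaw, if_pos ht]
      refine ⟨hφ.1, hφ.2.1, ?_, ih hφ.2.2.2⟩
      have hI : ¬ Touches sim f r → ∃ g ∈ I, sim g f := by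
        intro hr
        obtain ⟨J, hJ, g, hg, h⟩ := ht
        rcases List.mem_cons.mp hJ with rfl | hJ
        · exact ⟨g, hg, hsym h⟩
        · exact absurd ⟨J, hJ, g, hg, h⟩ hr
      cases r with
      | nil =>
        intro J hJ g hg
        simp only [insertFlaw, List.head?_cons, Option.mem_def, Option.some.injEq] at hJ
        subst hJ
        rw [Finset.mem_singleton.mp hg]
        exact hI (by rintro ⟨J, hJ, -⟩; simp at hJ)
      | cons K s =>
        have hK := hφ.2.2.1 K (by simp)
        intro J hJ g hg
        by_cases hr : Touches sim f (K :: s)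
        · simp only [insertFlaw, if_pos hr, List.head?_cons, Option.mem_def,
            Option.some.injEq] at hJ
          subst hJ
          exact hK g hg
        · simp only [insertFlaw, if_neg hr, List.head?_cons, Option.mem_def,
            Option.some.injEq] at hJ
          subst hJ
          rcases Finset.mem_insert.mp hg with rfl | hg
          · exact hI hr
          · exact hK g hg
    · rw [insertFlaw, if_neg ht]
      refine ⟨indepF_insert hsym hφ.1 fun g hg h => ht ⟨I, List.mem_cons_self, g, hg, h⟩,
        Finset.insert_ne_empty _ _, ?_, hφ.2.2.2⟩
      intro J hJ g hg
      obtain ⟨e, he, h⟩ := hφ.2.2.1 J hJ g hg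
      exact ⟨e, Finset.mem_insert_of_mem he, h⟩

theorem exists_mem_insertFlaw (sim : F → F → Prop) (f : F) (φ : List (Finset F)) :
    ∃ J ∈ insertFlaw sim f φ, f ∈ J := by
  induction φ with
  | nil => exact ⟨{f}, by simp [insertFlaw], by simp⟩
  | cons I r ih =>
    by_cases ht : Touches sim f (I :: r)
    · obtain ⟨J, hJ, h⟩ := ih
      exact ⟨J, by rw [insertFlaw, if_pos ht]; exact List.mem_cons_of_mem _ hJ, h⟩
    · exact ⟨insert f I, by rw [insertFlaw, if_neg ht]; exact List.mem_cons_self, by simp⟩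

theorem touches_of_mem_tail {sim : F → F → Prop} (hsym : Symmetric sim) {f : F}
    {r : List (Finset F)} : ∀ {I : Finset F}, NormalSeq sim (I :: r) →
      (∃ J ∈ r, f ∈ J) → Touches sim f (I :: r) := by
  induction r with
  | nil => rintro I - ⟨J, hJ, -⟩; simp at hJ
  | cons K s ih =>
    rintro I hφ ⟨J, hJ, hf⟩
    rcases List.mem_cons.mp hJ with rfl | hJ
    · obtain ⟨e, he, h⟩ := hφ.2.2.1 J (by simp) f hf
      exact ⟨I, List.mem_cons_self, e, he, hsym h⟩
    · obtain ⟨L, hL, h⟩ := ih hφ.2.2.2 ⟨J, hJ, hf⟩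
      exact ⟨L, List.mem_cons_of_mem _ hL, h⟩

theorem insertFlaw_ne_singleton (S : Setup Ω F) (sim : F → F → Prop) (hsym : Symmetric sim)
    (hcaus : Causality S sim) (hsc : StrongComm S sim) {f : F} {I : Finset F}
    {r : List (Finset F)} (hφ : NormalSeq sim (I :: r))
    (h0 : flawMatrix S f * seqMatrix S (I :: r) ≠ 0) :
    insertFlaw sim f (I :: r) ≠ [{f}] := by
  intro h
  by_cases ht : Touches sim f (I :: r)
  · rw [insertFlaw, if_pos ht] at h
    obtain ⟨J, hJ, -⟩ := exists_mem_insertFlaw sim f r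
    simp only [List.cons.injEq] at h
    rw [h.2] at hJ
    simp at hJ
  · have hf := notMem_of_mul_ne_zero S sim hsym hcaus hsc hφ.1 ht h0
    rw [insertFlaw, if_neg ht] at h
    simp only [List.cons.injEq] at h
    obtain ⟨g, hg⟩ := Finset.nonempty_iff_ne_empty.mpr hφ.2.1
    have hg' : g ∈ ({f} : Finset F) := h.1 ▸ Finset.mem_insert_of_mem hg
    rw [Finset.mem_singleton.mp hg'] at hg
    exact hf hg

theorem insertFlaw_injective (S : Setup Ω F) (sim : F → F → Prop) (hsym : Symmetric sim)
    (hcaus : Causality S sim) (hsc : StrongComm S sim) {f : F} (φ : List (Finset F)) :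
    ∀ ψ : List (Finset F), NormalSeq sim φ → NormalSeq sim ψ →
      flawMatrix S f * seqMatrix S φ ≠ 0 → flawMatrix S f * seqMatrix S ψ ≠ 0 →
      insertFlaw sim f φ = insertFlaw sim f ψ → φ = ψ := by
  induction φ with
  | nil =>
    intro ψ _ hψ _ h0 h
    cases ψ with
    | nil => rfl
    | cons I r => exact absurd h.symm (insertFlaw_ne_singleton S sim hsym hcaus hsc hψ h0)
  | cons I r ih =>
    intro ψ hφ hψ h0 h0' h
    cases ψ with
    | nil => exact absurd h (insertFlaw_ne_singleton S sim hsym hcaus hsc hφ h0)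
    | cons I' r' =>
      by_cases ht : Touches sim f (I :: r) <;> by_cases ht' : Touches sim f (I' :: r')
      · simp only [insertFlaw, if_pos ht, if_pos ht', List.cons.injEq] at h
        rw [h.1, ih r' hφ.2.2.2 hψ.2.2.2 (tail_mul_ne_zero h0) (tail_mul_ne_zero h0') h.2]
      · simp only [insertFlaw, if_pos ht, if_neg ht', List.cons.injEq] at h
        exact absurd (touches_of_mem_tail hsym hψ (h.2 ▸ exists_mem_insertFlaw sim f r)) ht'
      · simp only [insertFlaw, if_neg ht, if_pos ht', List.cons.injEq] at h
        exact absurd (touches_of_mem_tail hsym hφ (h.2 ▸ exists_mem_insertFlaw sim f r')) ht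
      · have hf := notMem_of_mul_ne_zero S sim hsym hcaus hsc hφ.1 ht h0
        have hf' := notMem_of_mul_ne_zero S sim hsym hcaus hsc hψ.1 ht' h0'
        simp only [insertFlaw, if_neg ht, if_neg ht', List.cons.injEq] at h
        rw [← Finset.erase_insert hf, ← Finset.erase_insert hf', h.1, h.2]

/-- The normal forms of the words of length `t` that can be realized by walks. -/
def normalForms [Fintype F] (S : Setup Ω F) (sim : F → F → Prop) :
    ℕ → Finset (List (Finset F))
  | 0 => {[]}
  | t + 1 => Finset.univ.biUnion fun f =>
      ((normalForms S sim t).filter fun φ => flawMatrix S f * seqMatrix S φ ≠ 0).image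
        (insertFlaw sim f)

theorem normalForms_spec [Fintype F] (S : Setup Ω F) (sim : F → F → Prop)
    (hsym : Symmetric sim) (hcaus : Causality S sim) (hsc : StrongComm S sim) (t : ℕ) :
    ∀ φ ∈ normalForms S sim t, NormalSeq sim φ ∧ seqSize φ = t := by
  induction t with
  | zero => simp [normalForms, NormalSeq, seqSize]
  | succ t ih =>
    intro φ hφ
    simp only [normalForms, Finset.mem_biUnion, Finset.mem_univ, true_and, Finset.mem_image,
      Finset.mem_filter] at hφ
    obtain ⟨f, ψ, ⟨hψ, h0⟩, rfl⟩ := hφ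
    obtain ⟨hN, hs⟩ := ih ψ hψ
    exact ⟨normalSeq_insertFlaw sim hsym ψ hN, by
      rw [seqSize_insertFlaw S sim hsym hcaus hsc ψ hN h0, hs]⟩

/-- A nonnegative matrix which multiplies the row vector `ω` by at most `c`. -/
def Dominated (ω : Ω → ℝ) (M : Matrix Ω Ω ℝ) (c : ℝ) : Prop :=
  (∀ σ σ', 0 ≤ M σ σ') ∧ ∀ σ', ∑ σ, ω σ * M σ σ' ≤ c * ω σ'

theorem dominated_one (ω : Ω → ℝ) : Dominated ω (1 : Matrix Ω Ω ℝ) 1 := by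
  constructor
  · intro σ σ'
    rw [Matrix.one_apply]
    split_ifs <;> norm_num
  · intro σ'
    simp [Matrix.one_apply]

theorem Dominated.mul {ω : Ω → ℝ} {M N : Matrix Ω Ω ℝ} {c d : ℝ} (hM : Dominated ω M c)
    (hN : Dominated ω N d) (hc : 0 ≤ c) : Dominated ω (M * N) (c * d) := by
  constructor
  · intro σ σ'
    rw [Matrix.mul_apply]
    exact Finset.sum_nonneg fun τ _ => mul_nonneg (hM.1 _ _) (hN.1 _ _)
  · intro σ'
    calc ∑ σ, ω σ * (M * N) σ σ' = ∑ τ, (∑ σ, ω σ * M σ τ) * N τ σ' := by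
          simp only [Matrix.mul_apply, Finset.mul_sum, Finset.sum_mul]
          rw [Finset.sum_comm]
          exact Finset.sum_congr rfl fun _ _ => Finset.sum_congr rfl fun _ _ => by ring
      _ ≤ ∑ τ, (c * ω τ) * N τ σ' :=
          Finset.sum_le_sum fun τ _ => mul_le_mul_of_nonneg_right (hM.2 τ) (hN.1 _ _)
      _ = c * ∑ τ, ω τ * N τ σ' := by
          rw [Finset.mul_sum]
          exact Finset.sum_congr rfl fun _ _ => by ring
      _ ≤ c * (d * ω σ') := mul_le_mul_of_nonneg_left (hN.2 _) hc
      _ = c * d * ω σ' := by ring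

theorem dominated_flawMatrix (S : Setup Ω F) {ω : Ω → ℝ} (hω : ∀ σ, 0 < ω σ) {lam : F → ℝ}
    (hA : CondA S ω lam) (f : F) : Dominated ω (flawMatrix S f) (lam f) := by
  refine ⟨flawMatrix_nonneg S f, fun σ' => ?_⟩
  have h := mul_le_mul_of_nonneg_right (hA f σ') (hω σ').le
  refine le_trans (le_of_eq ?_) h
  rw [Finset.sum_mul]
  refine Finset.sum_congr rfl fun σ _ => ?_
  have := (hω σ').ne'
  simp only [flawMatrix, Matrix.of_apply]
  by_cases hs : S.mem f σ ∧ σ' ∈ S.Act f σ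
  · rw [if_pos hs, if_pos (show S.step f σ σ' from hs)]
    field_simp
  · rw [if_neg hs, if_neg (show ¬ S.step f σ σ' from hs), mul_zero, zero_mul]

theorem dominated_blockMatrix (S : Setup Ω F) {ω : Ω → ℝ} (hω : ∀ σ, 0 < ω σ) {lam : F → ℝ}
    (hlam : ∀ f, 0 < lam f) (hA : CondA S ω lam) (I : Finset F) :
    Dominated ω (blockMatrix S I) (∏ f ∈ I, lam f) := by
  rw [← Finset.prod_map_toList, blockMatrix]
  induction I.toList with
  | nil => simpa using dominated_one ω
  | cons f l ih =>
    simp only [List.map_cons, List.prod_cons]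
    exact (dominated_flawMatrix S hω hA f).mul ih (hlam f).le

theorem seqWt_nonneg {lam : F → ℝ} (hlam : ∀ f, 0 < lam f) (φ : List (Finset F)) :
    0 ≤ seqWt lam φ := by
  apply List.prod_nonneg
  intro a ha
  obtain ⟨I, -, rfl⟩ := List.mem_map.mp ha
  exact Finset.prod_nonneg fun f _ => (hlam f).le

theorem dominated_seqMatrix (S : Setup Ω F) {ω : Ω → ℝ} (hω : ∀ σ, 0 < ω σ) {lam : F → ℝ}
    (hlam : ∀ f, 0 < lam f) (hA : CondA S ω lam) (φ : List (Finset F)) :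
    Dominated ω (seqMatrix S φ) (seqWt lam φ) := by
  induction φ with
  | nil => simpa [seqWt, seqMatrix] using dominated_one ω
  | cons I r ih =>
    have h := ih.mul (dominated_blockMatrix S hω hlam hA I) (seqWt_nonneg hlam r)
    rw [mul_comm] at h
    simpa [seqWt, seqMatrix, mul_comm] using h

/-- The total weight from `σ` of all normal forms of size `t`. -/
def potential [Fintype F] (S : Setup Ω F) (sim : F → F → Prop) (t : ℕ) (σ : Ω) : ℝ :=
  ∑ φ ∈ normalForms S sim t, ∑ σ', seqMatrix S φ σ σ'

theorem seqMatrix_nonneg (S : Setup Ω F) (φ : List (Finset F)) (σ σ' : Ω) :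
    0 ≤ seqMatrix S φ σ σ' := by
  have hmul : ∀ M N : Matrix Ω Ω ℝ, (∀ a b, 0 ≤ M a b) → (∀ a b, 0 ≤ N a b) →
      ∀ a b, 0 ≤ (M * N) a b := fun M N hM hN a b => by
    rw [Matrix.mul_apply]
    exact Finset.sum_nonneg fun τ _ => mul_nonneg (hM _ _) (hN _ _)
  have hone : ∀ a b : Ω, 0 ≤ (1 : Matrix Ω Ω ℝ) a b := fun a b => by
    rw [Matrix.one_apply]
    split_ifs <;> norm_num
  induction φ generalizing σ σ' with
  | nil => exact hone σ σ'
  | cons I r ih =>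
    refine hmul _ _ ih ?_ σ σ'
    rw [blockMatrix]
    induction I.toList with
    | nil => simpa using hone
    | cons f l ihl =>
      simp only [List.map_cons, List.prod_cons]
      exact hmul _ _ (flawMatrix_nonneg S f) ihl

theorem flawMatrix_potential_le [Fintype F] (S : Setup Ω F) (sim : F → F → Prop)
    (hsym : Symmetric sim) (hcaus : Causality S sim) (hsc : StrongComm S sim) (t : ℕ) (f : F)
    (σ : Ω) : ∑ σ', flawMatrix S f σ σ' * potential S sim t σ' ≤ potential S sim (t + 1) σ := by
  have hspec := normalForms_spec S sim hsym hcaus hsc t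
  calc ∑ σ', flawMatrix S f σ σ' * potential S sim t σ'
      = ∑ φ ∈ normalForms S sim t, ∑ σ'', (flawMatrix S f * seqMatrix S φ) σ σ'' := by
        simp only [potential, Matrix.mul_apply, Finset.mul_sum]
        rw [Finset.sum_comm]
        exact Finset.sum_congr rfl fun _ _ => Finset.sum_comm
    _ = ∑ φ ∈ (normalForms S sim t).filter fun φ => flawMatrix S f * seqMatrix S φ ≠ 0,
          ∑ σ'', (flawMatrix S f * seqMatrix S φ) σ σ'' := by
        rw [Finset.sum_filter]
        refine Finset.sum_congr rfl fun φ _ => ?_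
        by_cases h : flawMatrix S f * seqMatrix S φ = 0
        · simp [h]
        · simp [h]
    _ = ∑ ψ ∈ ((normalForms S sim t).filter fun φ => flawMatrix S f * seqMatrix S φ ≠ 0).image
          (insertFlaw sim f), ∑ σ'', seqMatrix S ψ σ σ'' := by
        rw [Finset.sum_image]
        · refine Finset.sum_congr rfl fun φ hφ => ?_
          obtain ⟨h1, h2⟩ := Finset.mem_filter.mp hφ
          rw [seqMatrix_insertFlaw S sim hsym hcaus hsc φ (hspec φ h1).1 h2]
        · intro φ hφ ψ hψ h
          obtain ⟨h1, h2⟩ := Finset.mem_filter.mp hφ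
          obtain ⟨h3, h4⟩ := Finset.mem_filter.mp hψ
          exact insertFlaw_injective S sim hsym hcaus hsc φ ψ (hspec φ h1).1 (hspec ψ h3).1
            h2 h4 h
    _ ≤ potential S sim (t + 1) σ := by
        refine Finset.sum_le_sum_of_subset_of_nonneg ?_ fun φ _ _ =>
          Finset.sum_nonneg fun _ _ => seqMatrix_nonneg S φ _ _
        exact Finset.subset_biUnion_of_mem (fun f => ((normalForms S sim t).filter fun φ =>
          flawMatrix S f * seqMatrix S φ ≠ 0).image (insertFlaw sim f)) (Finset.mem_univ f)

theorem potential_nonneg [Fintype F] (S : Setup Ω F) (sim : F → F → Prop) (t : ℕ) (σ : Ω) :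
    0 ≤ potential S sim t σ :=
  Finset.sum_nonneg fun φ _ => Finset.sum_nonneg fun _ _ => seqMatrix_nonneg S φ _ _

end Matrices

theorem sum_eq_sum_preimage_cons {α : Type*} (X : Finset (List α)) (Y : Finset α)
    (hX : ∀ l ∈ X, ∃ a ∈ Y, ∃ l', l = a :: l') (g : List α → ℝ) :
    ∑ l ∈ X, g l = ∑ a ∈ Y, ∑ l' ∈ X.preimage (List.cons a) List.cons_injective.injOn,
      g (a :: l') := by
  rw [Finset.sum_sigma']
  symm
  refine Finset.sum_bij (fun p _ => p.1 :: p.2) ?_ ?_ ?_ ?_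
  · intro p hp
    simpa using (Finset.mem_sigma.mp hp).2
  · rintro ⟨a, l⟩ _ ⟨b, m⟩ _ h
    simp only [List.cons.injEq] at h
    simp [h.1, h.2]
  · intro l hl
    obtain ⟨a, ha, l', rfl⟩ := hX l hl
    exact ⟨⟨a, l'⟩, by simp [ha, hl], rfl⟩
  · intro p _
    rfl

theorem sum_prodRho_le {Ω F : Type*} [Fintype Ω] [Fintype F] (S : Setup Ω F)
    (sim : F → F → Prop) (hsym : Symmetric sim) (hcaus : Causality S sim)
    (hsc : StrongComm S sim) (t : ℕ) : ∀ (Λ : List (F × Ω) → F) (σ : Ω)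
      (X : Finset (List (F × Ω))),
      (∀ l ∈ X, ValidFrom S.step σ l ∧ l.length = t ∧
        ∀ (i : ℕ) (h : i < l.length), (l.get ⟨i, h⟩).1 = Λ (l.take i)) →
      ∑ l ∈ X, prodRho S.ρ σ l ≤ potential S sim t σ := by
  induction t with
  | zero =>
    intro Λ σ X hX
    have hsub : X ⊆ {[]} := fun l hl => by
      simpa using List.length_eq_zero_iff.mp (hX l hl).2.1
    calc ∑ l ∈ X, prodRho S.ρ σ l ≤ ∑ l ∈ ({[]} : Finset (List (F × Ω))), prodRho S.ρ σ l := by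
          refine Finset.sum_le_sum_of_subset_of_nonneg hsub fun l hl _ => ?_
          rw [Finset.mem_singleton.mp hl, prodRho]
          exact zero_le_one
      _ = potential S sim 0 σ := by
          simp [potential, normalForms, seqMatrix, prodRho, Matrix.one_apply]
  | succ t ih =>
    intro Λ σ X hX
    have hcons : ∀ l ∈ X, ∃ a ∈ Finset.univ.image (fun σ' : Ω => (Λ [], σ')),
        ∃ l', l = a :: l' := by
      intro l hl
      obtain ⟨-, hlen, hfol⟩ := hX l hl
      cases l with
      | nil => simp at hlen
      | cons a l' =>
        refine ⟨a, ?_, l', rfl⟩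
        have := hfol 0 (by simp)
        simp only [List.get_eq_getElem, List.getElem_cons_zero, List.take_zero] at this
        exact Finset.mem_image.mpr ⟨a.2, Finset.mem_univ _, by rw [← this]⟩
    rw [sum_eq_sum_preimage_cons X _ hcons, Finset.sum_image (by
      intro a _ b _ h
      exact (Prod.mk.inj h).2)]
    refine le_trans (Finset.sum_le_sum fun σ' _ => ?_)
      (flawMatrix_potential_le S sim hsym hcaus hsc t (Λ []) σ)
    simp only [prodRho]
    rw [← Finset.mul_sum]
    by_cases hstep : S.step (Λ []) σ σ'
    · simp only [flawMatrix, Matrix.of_apply, if_pos hstep]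
      refine mul_le_mul_of_nonneg_left ?_ (S.ρ_nonneg _ _ _)
      refine ih (fun l => Λ ((Λ [], σ') :: l)) σ' _ fun l hl => ?_
      rw [Finset.mem_preimage] at hl
      obtain ⟨hv, hlen, hfol⟩ := hX _ hl
      refine ⟨hv.2, by simpa using hlen, fun i hi => ?_⟩
      simpa using hfol (i + 1) (by simpa using hi)
    · rw [Finset.sum_eq_zero, mul_zero]
      · exact mul_nonneg (flawMatrix_nonneg _ _ _ _) (potential_nonneg _ _ _ _)
      · intro l hl
        rw [Finset.mem_preimage] at hl
        exact absurd (hX _ hl).1.1 hstep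

section ClusterExpansion

variable {F : Type*} [Fintype F]

/-- The independent sets of flaws satisfying `P`. -/
def indepSets (sim : F → F → Prop) (P : F → Prop) : Finset (Finset F) :=
  Finset.univ.filter fun I : Finset F => (∀ g ∈ I, P g) ∧ IndepF sim I

/-- The sum of `μ` over the independent sets of flaws satisfying `P`. -/
def indepSum (sim : F → F → Prop) (μ : F → ℝ) (P : F → Prop) : ℝ :=
  ∑ I ∈ indepSets sim P, ∏ g ∈ I, μ g

theorem mem_indepSets {sim : F → F → Prop} {P : F → Prop} {I : Finset F} :
    I ∈ indepSets sim P ↔ (∀ g ∈ I, P g) ∧ IndepF sim I := by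
  simp [indepSets]

theorem indepSum_nonneg (sim : F → F → Prop) {μ : F → ℝ} (hμ : ∀ f, 0 < μ f) (P : F → Prop) :
    0 ≤ indepSum sim μ P :=
  Finset.sum_nonneg fun _ _ => Finset.prod_nonneg fun f _ => (hμ f).le

theorem indepSum_or_le (sim : F → F → Prop) {μ : F → ℝ} (hμ : ∀ f, 0 < μ f)
    (P Q : F → Prop) :
    indepSum sim μ (fun g => P g ∨ Q g) ≤ indepSum sim μ P * indepSum sim μ Q := by
  rw [indepSum, indepSum, indepSum, Finset.sum_mul_sum, ← Finset.sum_product']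
  set split : Finset F → Finset F × Finset F := fun I => (I.filter P, I.filter fun g => ¬ P g)
  have hinj : Function.Injective split := by
    intro I J h
    have h := Prod.mk.inj h
    rw [← Finset.filter_union_filter_not_eq P I, ← Finset.filter_union_filter_not_eq P J,
      h.1, h.2]
  calc _ = ∑ p ∈ (indepSets sim fun g => P g ∨ Q g).image split,
          (∏ g ∈ p.1, μ g) * ∏ g ∈ p.2, μ g := by
        rw [Finset.sum_image hinj.injOn]
        exact Finset.sum_congr rfl fun I _ => (Finset.prod_filter_mul_prod_filter_not I P μ).symm
    _ ≤ _ := by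
        refine Finset.sum_le_sum_of_subset_of_nonneg ?_ fun p _ _ => mul_nonneg
          (Finset.prod_nonneg fun f _ => (hμ f).le) (Finset.prod_nonneg fun f _ => (hμ f).le)
        intro p hp
        obtain ⟨I, hI, rfl⟩ := Finset.mem_image.mp hp
        obtain ⟨h1, h2⟩ := mem_indepSets.mp hI
        simp only [split, Finset.mem_product, mem_indepSets, Finset.mem_filter]
        exact ⟨⟨fun g hg => hg.2, indepF_mono (Finset.filter_subset _ _) h2⟩,
          ⟨fun g hg => (h1 g hg.1).resolve_left hg.2,
            indepF_mono (Finset.filter_subset _ _) h2⟩⟩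

theorem indepSum_neighbours_le (sim : F → F → Prop) {μ : F → ℝ} (hμ : ∀ f, 0 < μ f)
    (J : Finset F) :
    indepSum sim μ (fun g => ∃ f ∈ J, sim f g) ≤ ∏ f ∈ J, indepSum sim μ (sim f) := by
  induction J using Finset.induction_on with
  | empty =>
    have : indepSets sim (fun g => ∃ f ∈ (∅ : Finset F), sim f g) ⊆ {∅} := by
      intro I hI
      rw [Finset.mem_singleton, Finset.eq_empty_iff_forall_notMem]
      intro g hg
      obtain ⟨f, hf, -⟩ := (mem_indepSets.mp hI).1 g hg
      simp at hf
    calc indepSum sim μ (fun g => ∃ f ∈ (∅ : Finset F), sim f g)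
        ≤ ∑ I ∈ ({∅} : Finset (Finset F)), ∏ g ∈ I, μ g :=
          Finset.sum_le_sum_of_subset_of_nonneg this fun _ _ _ =>
            Finset.prod_nonneg fun f _ => (hμ f).le
      _ = _ := by simp
  | insert f J hf ih =>
    rw [Finset.prod_insert hf]
    have heq : (fun g => ∃ e ∈ insert f J, sim e g) =
        fun g => sim f g ∨ ∃ e ∈ J, sim e g := by
      funext g
      simp
    rw [heq]
    exact (indepSum_or_le sim hμ _ _).trans
      (mul_le_mul_of_nonneg_left ih (indepSum_nonneg sim hμ _))

theorem prod_lam_mul_indepSum_le {sim : F → F → Prop} {lam μ : F → ℝ} {θ : ℝ}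
    (hlam : ∀ f, 0 < lam f) (hμ : ∀ f, 0 < μ f) (hCE : ClusterCond sim lam μ θ)
    (J : Finset F) :
    (∏ f ∈ J, lam f) * indepSum sim μ (fun g => ∃ f ∈ J, sim f g) ≤
      (∏ f ∈ J, μ f) * θ ^ J.card := by
  calc _ ≤ (∏ f ∈ J, lam f) * ∏ f ∈ J, indepSum sim μ (sim f) :=
        mul_le_mul_of_nonneg_left (indepSum_neighbours_le sim hμ J)
          (Finset.prod_nonneg fun f _ => (hlam f).le)
    _ = ∏ f ∈ J, lam f * indepSum sim μ (sim f) := Finset.prod_mul_distrib.symm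
    _ ≤ ∏ f ∈ J, μ f * θ := by
        refine Finset.prod_le_prod (fun f _ => mul_nonneg (hlam f).le
          (indepSum_nonneg sim hμ _)) fun f _ => ?_
        have h : lam f / μ f * indepSum sim μ (sim f) ≤ θ := hCE f
        rwa [div_mul_eq_mul_div, div_le_iff₀ (hμ f), mul_comm θ] at h
    _ = _ := by rw [Finset.prod_mul_distrib, Finset.prod_const]

theorem sum_seqWt_le {sim : F → F → Prop} {lam μ : F → ℝ} {θ : ℝ}
    (hlam : ∀ f, 0 < lam f) (hμ : ∀ f, 0 < μ f) (hθ : 0 < θ) (hCE : ClusterCond sim lam μ θ)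
    (n : ℕ) : ∀ (P : F → Prop) (X : Finset (List (Finset F))),
      (∀ φ ∈ X, NormalSeq sim φ ∧ seqSize φ = n ∧ ∀ J ∈ φ.head?, ∀ g ∈ J, P g) →
      ∑ φ ∈ X, seqWt lam φ ≤ indepSum sim μ P * θ ^ n := by
  induction n using Nat.strong_induction_on with
  | _ n ih =>
  intro P X hX
  have hterm : ∀ I : Finset F, 0 ≤ ∏ g ∈ I, μ g := fun I =>
    Finset.prod_nonneg fun f _ => (hμ f).le
  rcases Nat.eq_zero_or_pos n with rfl | hn
  · have hsub : X ⊆ {[]} := by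
      intro φ hφ
      obtain ⟨hN, hs, -⟩ := hX φ hφ
      cases φ with
      | nil => simp
      | cons I r =>
        have : 0 < I.card := Finset.card_pos.mpr (Finset.nonempty_iff_ne_empty.mpr hN.2.1)
        simp only [seqSize, List.map_cons, List.sum_cons] at hs
        omega
    calc ∑ φ ∈ X, seqWt lam φ ≤ ∑ φ ∈ ({[]} : Finset (List (Finset F))), seqWt lam φ :=
          Finset.sum_le_sum_of_subset_of_nonneg hsub fun φ _ _ => seqWt_nonneg hlam φ
      _ = ∏ g ∈ (∅ : Finset F), μ g := by simp [seqWt]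
      _ ≤ indepSum sim μ P := Finset.single_le_sum (f := fun I : Finset F => ∏ g ∈ I, μ g)
          (fun I _ => hterm I) (mem_indepSets.mpr (by simp [IndepF]))
      _ = _ := by simp
  · have hcons : ∀ φ ∈ X, ∃ J ∈ indepSets sim P, ∃ r, φ = J :: r := by
      intro φ hφ
      obtain ⟨hN, hs, hP⟩ := hX φ hφ
      cases φ with
      | nil => simp [seqSize] at hs; omega
      | cons I r => exact ⟨I, mem_indepSets.mpr ⟨hP I (by simp), hN.1⟩, r, rfl⟩
    rw [sum_eq_sum_preimage_cons X _ hcons, indepSum, Finset.sum_mul]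
    refine Finset.sum_le_sum fun J _ => ?_
    simp only [seqWt, List.map_cons, List.prod_cons]
    rw [← Finset.mul_sum]
    set Y := X.preimage (List.cons J) List.cons_injective.injOn with hY
    rcases Y.eq_empty_or_nonempty with he | ⟨r₀, hr₀⟩
    · rw [he, Finset.sum_empty, mul_zero]
      exact mul_nonneg (hterm J) (pow_nonneg hθ.le _)
    · have hmem : ∀ r ∈ Y, NormalSeq sim (J :: r) ∧ seqSize (J :: r) = n := fun r hr => by
        rw [hY, Finset.mem_preimage] at hr
        exact ⟨(hX _ hr).1, (hX _ hr).2.1⟩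
      have hpos : 0 < J.card :=
        Finset.card_pos.mpr (Finset.nonempty_iff_ne_empty.mpr (hmem r₀ hr₀).1.2.1)
      have hle : J.card ≤ n := by
        have := (hmem r₀ hr₀).2
        simp only [seqSize, List.map_cons, List.sum_cons] at this
        omega
      have hrec : ∑ r ∈ Y, seqWt lam r ≤
          indepSum sim μ (fun g => ∃ f ∈ J, sim f g) * θ ^ (n - J.card) := by
        refine ih (n - J.card) (by omega) _ Y fun r hr => ?_
        obtain ⟨hN, hs⟩ := hmem r hr
        refine ⟨hN.2.2.2, ?_, hN.2.2.1⟩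
        simp only [seqSize, List.map_cons, List.sum_cons] at hs ⊢
        omega
      calc (∏ f ∈ J, lam f) * ∑ r ∈ Y, seqWt lam r
          ≤ (∏ f ∈ J, lam f) *
            (indepSum sim μ (fun g => ∃ f ∈ J, sim f g) * θ ^ (n - J.card)) :=
            mul_le_mul_of_nonneg_left hrec (Finset.prod_nonneg fun f _ => (hlam f).le)
        _ = (∏ f ∈ J, lam f) * indepSum sim μ (fun g => ∃ f ∈ J, sim f g) *
              θ ^ (n - J.card) := by ring
        _ ≤ (∏ f ∈ J, μ f) * θ ^ J.card * θ ^ (n - J.card) :=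
            mul_le_mul_of_nonneg_right (prod_lam_mul_indepSum_le hlam hμ hCE J)
              (pow_nonneg hθ.le _)
        _ = (∏ f ∈ J, μ f) * θ ^ n := by
            rw [mul_assoc, ← pow_add, Nat.add_sub_cancel' hle]

end ClusterExpansion

theorem sum_potential_le {Ω F : Type*} [Fintype Ω] [Fintype F] (S : Setup Ω F)
    (sim : F → F → Prop) {ω : Ω → ℝ} (hω : IsPosProb ω) {lam : F → ℝ}
    (hlam : ∀ f, 0 < lam f) (hA : CondA S ω lam) (t : ℕ) :
    ∑ σ, ω σ * potential S sim t σ ≤ ∑ φ ∈ normalForms S sim t, seqWt lam φ := by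
  calc ∑ σ, ω σ * potential S sim t σ
      = ∑ φ ∈ normalForms S sim t, ∑ σ', ∑ σ, ω σ * seqMatrix S φ σ σ' := by
        simp only [potential, Finset.mul_sum]
        rw [Finset.sum_comm]
        exact Finset.sum_congr rfl fun _ _ => Finset.sum_comm
    _ ≤ ∑ φ ∈ normalForms S sim t, ∑ σ', seqWt lam φ * ω σ' :=
        Finset.sum_le_sum fun φ _ => Finset.sum_le_sum fun σ' _ =>
          (dominated_seqMatrix S hω.1 hlam hA φ).2 σ'
    _ = ∑ φ ∈ normalForms S sim t, seqWt lam φ := by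
        simp only [← Finset.mul_sum, hω.2, mul_one]

theorem sum_wt_bad_le {Ω F : Type*} [Fintype Ω] [Fintype F] (S : Setup Ω F)
    (sim : F → F → Prop) (hsym : Symmetric sim) (hcaus : Causality S sim)
    (hsc : StrongComm S sim) {ωinit : Ω → ℝ} (hinit : ∀ σ, 0 ≤ ωinit σ)
    (Λ : Walk Ω F → F) (t : ℕ) (hfin : (Bad S Λ ωinit t).Finite) :
    ∑ τ ∈ hfin.toFinset, Walk.wt ωinit S.ρ τ ≤ ∑ σ, ωinit σ * potential S sim t σ := by
  have hinj : ∀ σ : Ω, Function.Injective (fun l : List (F × Ω) => Walk.mk σ l) :=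
    fun σ l m h => (Walk.mk.inj h).2
  have hsum : ∑ τ ∈ hfin.toFinset, Walk.wt ωinit S.ρ τ =
      ∑ σ, ∑ l ∈ hfin.toFinset.preimage (fun l => Walk.mk σ l) (hinj σ).injOn,
        ωinit σ * prodRho S.ρ σ l := by
    rw [Finset.sum_sigma']
    symm
    refine Finset.sum_bij (fun p _ => ⟨p.1, p.2⟩) ?_ ?_ ?_ ?_
    · intro p hp
      exact Finset.mem_preimage.mp (Finset.mem_sigma.mp hp).2
    · rintro ⟨a, l⟩ _ ⟨b, m⟩ _ h
      obtain ⟨h1, h2⟩ := Walk.mk.inj h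
      simp only at h1 h2
      rw [h1, h2]
    · intro τ hτ
      refine ⟨⟨τ.start, τ.steps⟩, ?_, rfl⟩
      rw [Finset.mem_sigma, Finset.mem_preimage]
      exact ⟨Finset.mem_univ _, hτ⟩
    · intro p _
      rfl
  rw [hsum]
  refine Finset.sum_le_sum fun σ _ => ?_
  rw [← Finset.mul_sum]
  refine mul_le_mul_of_nonneg_left ?_ (hinit σ)
  refine sum_prodRho_le S sim hsym hcaus hsc t (fun l => Λ ⟨σ, l⟩) σ _ fun l hl => ?_
  rw [Finset.mem_preimage, Set.Finite.mem_toFinset] at hl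
  exact ⟨hl.1, hl.2.1, hl.2.2.1⟩

/-- Theorem 1(c): if `(ρ,∼)` is strongly commutative, then for every
deterministic strategy, `∑_{τ∈Bad(t)} p(τ) ≤ γ^init (∑_{R∈Ind(F)} μ(R)) θ^t`. -/
theorem stmt_7 {Ω F : Type*} [Fintype Ω] [Nonempty Ω] [Fintype F]
    (S : Setup Ω F) (sim : F → F → Prop) (hsym : Symmetric sim) (hcaus : Causality S sim)
    (hsc : StrongComm S sim)
    (ω ωinit : Ω → ℝ) (hω : IsPosProb ω) (hinit : IsProb ωinit)
    (lam μ : F → ℝ) (θ : ℝ)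
    (hlam : ∀ f, 0 < lam f) (hμ : ∀ f, 0 < μ f) (hθ0 : 0 < θ) (hθ1 : θ < 1)
    (hA : CondA S ω lam) (hCE : ClusterCond sim lam μ θ)
    (Λ : Walk Ω F → F) (hΛ : IsStrategy S Λ) (t : ℕ)
    (hfin : (Bad S Λ ωinit t).Finite) :
    (∑ τ ∈ hfin.toFinset, Walk.wt ωinit S.ρ τ) ≤
      gammaInit ωinit ω *
        (∑ R ∈ Finset.univ.filter (fun R : Finset F => IndepF sim R), ∏ f ∈ R, μ f) *
        θ ^ t := by
  have hratio : ∀ σ, ωinit σ / ω σ ≤ gammaInit ωinit ω := fun σ =>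
    Finset.le_sup' (fun σ => ωinit σ / ω σ) (Finset.mem_univ σ)
  have hγ : 0 ≤ gammaInit ωinit ω := by
    obtain ⟨σ⟩ := ‹Nonempty Ω›
    exact (div_nonneg (hinit.1 σ) (hω.1 σ).le).trans (hratio σ)
  have hstab : ∑ φ ∈ normalForms S sim t, seqWt lam φ ≤
      (∑ R ∈ Finset.univ.filter (fun R : Finset F => IndepF sim R), ∏ f ∈ R, μ f) * θ ^ t := by
    have h := sum_seqWt_le hlam hμ hθ0 hCE t (fun _ => True) (normalForms S sim t)
      fun φ hφ => ⟨(normalForms_spec S sim hsym hcaus hsc t φ hφ).1,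
        (normalForms_spec S sim hsym hcaus hsc t φ hφ).2, fun _ _ _ _ => trivial⟩
    simpa [indepSum, indepSets] using h
  calc (∑ τ ∈ hfin.toFinset, Walk.wt ωinit S.ρ τ)
      ≤ ∑ σ, ωinit σ * potential S sim t σ :=
        sum_wt_bad_le S sim hsym hcaus hsc hinit.1 Λ t hfin
    _ ≤ ∑ σ, gammaInit ωinit ω * ω σ * potential S sim t σ :=
        Finset.sum_le_sum fun σ _ => mul_le_mul_of_nonneg_right
          ((div_le_iff₀ (hω.1 σ)).mp (hratio σ)) (potential_nonneg S sim t σ)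
    _ = gammaInit ωinit ω * ∑ σ, ω σ * potential S sim t σ := by
        rw [Finset.mul_sum]
        exact Finset.sum_congr rfl fun _ _ => mul_assoc _ _ _
    _ ≤ gammaInit ωinit ω *
        ((∑ R ∈ Finset.univ.filter (fun R : Finset F => IndepF sim R), ∏ f ∈ R, μ f) *
          θ ^ t) :=
        mul_le_mul_of_nonneg_left ((sum_potential_le S sim hω hlam hA t).trans hstab) hγ
    _ = _ := (mul_assoc _ _ _).symm

end LLLFormal
end
end

section
/- Assume λ ∈ ℝ^F satisfies condition (A). Let W be a word over F and let X be a valid set of walks such that W is a prefix of the flaw word of every walk in X. Then ∑_{τ∈X} p(τ) ≤ γ^init · λ_W. -/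
open scoped Classical

noncomputable section

namespace LLLFormal

/-- A finite sum over objects of the form `e i b` is the iterated sum over `i` and `b`. -/
theorem sum_eq_sum_preimage {α β ι : Type*} [Fintype ι] (e : ι → β → α)
    (he : ∀ i, Function.Injective (e i))
    (he' : ∀ i j b c, e i b = e j c → i = j) (s : Finset α)
    (hs : ∀ a ∈ s, ∃ i b, e i b = a) (g : α → ℝ) :
    ∑ a ∈ s, g a = ∑ i, ∑ b ∈ s.preimage (e i) (he i).injOn, g (e i b) := by
  rw [Finset.sum_sigma']
  symm
  refine Finset.sum_bij (fun x _ => e x.1 x.2) ?_ ?_ ?_ ?_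
  · intro x hx
    simpa using hx
  · rintro ⟨i, b⟩ _ ⟨j, c⟩ _ h
    obtain rfl := he' _ _ _ _ h
    obtain rfl := he _ h
    rfl
  · intro a ha
    obtain ⟨i, b, rfl⟩ := hs a ha
    exact ⟨⟨i, b⟩, by simpa using ha, rfl⟩
  · intros
    rfl

/-- The tails of the lists of `Y` that begin with `a`. -/
def tailsAfter {α : Type*} (a : α) (Y : Finset (List α)) : Finset (List α) :=
  Y.preimage (List.cons a) List.cons_injective.injOn

theorem mem_tailsAfter {α : Type*} {a : α} {Y : Finset (List α)} {l : List α} :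
    l ∈ tailsAfter a Y ↔ a :: l ∈ Y := by
  simp [tailsAfter]

/-- A prefix-free set of valid step lists from `σ` following the deterministic rule `R`. -/
structure StepTree {Ω F : Type*} [Fintype Ω] (S : Setup Ω F) (σ : Ω)
    (R : List (F × Ω) → F) (Y : Finset (List (F × Ω))) : Prop where
  valid : ∀ l ∈ Y, ValidFrom S.step σ l
  follows : ∀ l ∈ Y, ∀ (i : ℕ) (h : i < l.length), (l.get ⟨i, h⟩).1 = R (l.take i)
  prefixFree : ∀ l ∈ Y, ∀ l' ∈ Y, l <+: l' → l' = l

/-- The total weight of the paths from `σ` with flaw word `W`. -/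
def pathWt {Ω F : Type*} [Fintype Ω] (S : Setup Ω F) : List F → Ω → ℝ
  | [], _ => 1
  | f :: W, σ => ∑ σ', if S.step f σ σ' then S.ρ f σ σ' * pathWt S W σ' else 0

theorem Walk.mk_injective {Ω F : Type*} (σ : Ω) :
    Function.Injective (Walk.mk σ : List (F × Ω) → Walk Ω F) :=
  fun _ _ h => (Walk.mk.inj h).2

section

variable {Ω F : Type*} [Fintype Ω] {S : Setup Ω F}

theorem StepTree.tails {σ : Ω} {R : List (F × Ω) → F} {Y : Finset (List (F × Ω))}
    (hY : StepTree S σ R Y) (f : F) (σ' : Ω) :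
    StepTree S σ' (fun l => R ((f, σ') :: l)) (tailsAfter (f, σ') Y) where
  valid l hl := (hY.valid _ (mem_tailsAfter.1 hl)).2
  follows l hl i h := by
    have := hY.follows _ (mem_tailsAfter.1 hl) (i + 1) (by simpa using h)
    simpa using this
  prefixFree l hl l' hl' h := by
    have := hY.prefixFree _ (mem_tailsAfter.1 hl) _ (mem_tailsAfter.1 hl')
      (by simpa using h)
    simpa using this

theorem StepTree.sum_le_of_tails {σ : Ω} {R : List (F × Ω) → F} {Y : Finset (List (F × Ω))}
    (hY : StepTree S σ R Y) (f : F) (hf : ∀ l ∈ Y, ∃ σ' l', l = (f, σ') :: l') (b : Ω → ℝ)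
    (hb : ∀ σ', ∑ l ∈ tailsAfter (f, σ') Y, prodRho S.ρ σ' l ≤ b σ') :
    ∑ l ∈ Y, prodRho S.ρ σ l ≤ ∑ σ', if S.step f σ σ' then S.ρ f σ σ' * b σ' else 0 := by
  rw [sum_eq_sum_preimage (fun σ' l => (f, σ') :: l) (fun _ => List.cons_injective)
    (fun i j b c h => by simp at h; exact h.1) Y
    (fun l hl => by obtain ⟨σ', l', rfl⟩ := hf l hl; exact ⟨σ', l', rfl⟩)]
  refine Finset.sum_le_sum fun σ' _ => ?_
  change ∑ l ∈ tailsAfter (f, σ') Y, S.ρ f σ σ' * prodRho S.ρ σ' l ≤ _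
  split_ifs with hstep
  · rw [← Finset.mul_sum]
    exact mul_le_mul_of_nonneg_left (hb σ') (S.ρ_nonneg _ _ _)
  · rw [Finset.sum_eq_zero]
    intro l hl
    exact absurd (hY.valid _ (mem_tailsAfter.1 hl)).1 hstep

theorem Setup.sum_step_le_one (f : F) (σ : Ω) :
    ∑ σ', (if S.step f σ σ' then S.ρ f σ σ' * 1 else 0) ≤ 1 := by
  by_cases hm : S.mem f σ
  · refine (Finset.sum_le_sum fun σ' _ => ?_).trans_eq (S.ρ_total f σ hm)
    split_ifs
    · rw [mul_one]
    · exact S.ρ_nonneg _ _ _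
  · simp [Setup.step, hm]

theorem StepTree.sum_le_one {σ : Ω} {R : List (F × Ω) → F} {Y : Finset (List (F × Ω))}
    (hY : StepTree S σ R Y) : ∑ l ∈ Y, prodRho S.ρ σ l ≤ 1 := by
  obtain ⟨n, hn⟩ : ∃ n, ∀ l ∈ Y, l.length ≤ n :=
    ⟨Y.sup List.length, fun l hl => Finset.le_sup (f := List.length) hl⟩
  induction n generalizing σ R Y with
  | zero =>
    have hsub : Y ⊆ {[]} := fun l hl => by simpa using hn l hl
    rcases Finset.subset_singleton_iff.1 hsub with rfl | rfl <;> simp [prodRho]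
  | succ n ih =>
    by_cases h0 : [] ∈ Y
    · have : Y = {[]} := Finset.eq_singleton_iff_unique_mem.2
        ⟨h0, fun l hl => hY.prefixFree _ h0 _ hl List.nil_prefix⟩
      simp [this, prodRho]
    · refine (hY.sum_le_of_tails (R []) ?_ (fun _ => 1) ?_).trans
        (Setup.sum_step_le_one (R []) σ)
      · rintro (_ | ⟨⟨f, σ'⟩, l⟩) hl
        · exact absurd hl h0
        · have := hY.follows _ hl 0 (by simp)
          simp at this
          exact ⟨σ', l, by rw [this]⟩
      · intro σ'
        refine ih (hY.tails _ _) fun l hl => ?_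
        simpa using hn _ (mem_tailsAfter.1 hl)

theorem StepTree.sum_le_pathWt {W : List F} {σ : Ω} {R : List (F × Ω) → F}
    {Y : Finset (List (F × Ω))} (hY : StepTree S σ R Y)
    (hW : ∀ l ∈ Y, W <+: l.map Prod.fst) :
    ∑ l ∈ Y, prodRho S.ρ σ l ≤ pathWt S W σ := by
  induction W generalizing σ R Y with
  | nil => exact hY.sum_le_one
  | cons f W ih =>
    refine hY.sum_le_of_tails f ?_ _ fun σ' => ih (hY.tails f σ') fun l hl => ?_
    · rintro (_ | ⟨⟨g, σ'⟩, l⟩) hl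
      · simpa using hW _ hl
      · have := hW _ hl
        simp [List.cons_prefix_cons] at this
        exact ⟨σ', l, by rw [this.1]⟩
    · have := hW _ (mem_tailsAfter.1 hl)
      simpa [List.cons_prefix_cons] using this

theorem pathWt_nonneg (W : List F) (σ : Ω) : 0 ≤ pathWt S W σ := by
  induction W generalizing σ with
  | nil => exact zero_le_one
  | cons f W ih =>
    refine Finset.sum_nonneg fun σ' _ => ?_
    split_ifs
    · exact mul_nonneg (S.ρ_nonneg _ _ _) (ih σ')
    · exact le_rfl

theorem CondA.nonneg [Nonempty Ω] {ω : Ω → ℝ} {lam : F → ℝ} (hA : CondA S ω lam)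
    (hω : ∀ σ, 0 < ω σ) (f : F) : 0 ≤ lam f := by
  obtain ⟨σ'⟩ := ‹Nonempty Ω›
  refine (Finset.sum_nonneg fun σ _ => ?_).trans (hA f σ')
  split_ifs
  · exact div_nonneg (mul_nonneg (S.ρ_nonneg _ _ _) (hω σ).le) (hω σ').le
  · exact le_rfl

theorem CondA.sum_mul_le {ω : Ω → ℝ} {lam : F → ℝ} (hA : CondA S ω lam)
    (hω : ∀ σ, 0 < ω σ) (f : F) (σ' : Ω) :
    ∑ σ, (if S.step f σ σ' then ω σ * S.ρ f σ σ' else 0) ≤ lam f * ω σ' := by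
  refine le_trans (le_of_eq ?_) (mul_le_mul_of_nonneg_right (hA f σ') (hω σ').le)
  rw [Finset.sum_mul]
  refine Finset.sum_congr rfl fun σ _ => ?_
  have := (hω σ').ne'
  unfold Setup.step
  split_ifs
  · field_simp
  · rw [zero_mul]

theorem sum_mul_pathWt_le [Nonempty Ω] {ω : Ω → ℝ} {lam : F → ℝ} (hω : IsPosProb ω)
    (hA : CondA S ω lam) (W : List F) :
    ∑ σ, ω σ * pathWt S W σ ≤ wordWt lam W := by
  induction W with
  | nil => simp [pathWt, wordWt, hω.2]
  | cons f W ih =>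
    calc ∑ σ, ω σ * pathWt S (f :: W) σ
        = ∑ σ', (∑ σ, if S.step f σ σ' then ω σ * S.ρ f σ σ' else 0) * pathWt S W σ' := by
          simp only [pathWt, Finset.mul_sum, Finset.sum_mul]
          rw [Finset.sum_comm]
          refine Finset.sum_congr rfl fun σ' _ => Finset.sum_congr rfl fun σ _ => ?_
          split_ifs <;> ring
      _ ≤ ∑ σ', lam f * ω σ' * pathWt S W σ' :=
          Finset.sum_le_sum fun σ' _ =>
            mul_le_mul_of_nonneg_right (hA.sum_mul_le hω.1 f σ') (pathWt_nonneg W σ')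
      _ = lam f * ∑ σ', ω σ' * pathWt S W σ' := by
          simp only [Finset.mul_sum, mul_assoc]
      _ ≤ lam f * wordWt lam W := mul_le_mul_of_nonneg_left ih (hA.nonneg hω.1 f)
      _ = wordWt lam (f :: W) := by simp [wordWt]

theorem le_gammaInit_mul [Nonempty Ω] {ω ωinit : Ω → ℝ} (hω : ∀ σ, 0 < ω σ) (σ : Ω) :
    ωinit σ ≤ gammaInit ωinit ω * ω σ := by
  rw [← div_le_iff₀ (hω σ)]
  exact Finset.le_sup' (fun σ => ωinit σ / ω σ) (Finset.mem_univ σ)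

theorem gammaInit_nonneg [Nonempty Ω] {ω ωinit : Ω → ℝ} (hω : ∀ σ, 0 < ω σ)
    (hinit : ∀ σ, 0 ≤ ωinit σ) : 0 ≤ gammaInit ωinit ω := by
  obtain ⟨σ⟩ := ‹Nonempty Ω›
  exact (div_nonneg (hinit σ) (hω σ).le).trans
    (Finset.le_sup' (fun σ => ωinit σ / ω σ) (Finset.mem_univ σ))

end

/-- Theorem "calX": under condition (A), if `W` is a prefix of the flaw
word of every walk of a valid set `X`, then `∑_{τ∈X} p(τ) ≤ γ^init λ_W`. -/
theorem stmt_9 {Ω F : Type*} [Fintype Ω] [Nonempty Ω]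
    (S : Setup Ω F) (ω ωinit : Ω → ℝ) (hω : IsPosProb ω) (hinit : IsProb ωinit)
    (lam : F → ℝ) (hA : CondA S ω lam)
    (W : List F) (X : Finset (Walk Ω F)) (hX : ValidSet S ↑X)
    (hpre : ∀ τ ∈ X, W <+: Walk.word τ) :
    (∑ τ ∈ X, Walk.wt ωinit S.ρ τ) ≤ gammaInit ωinit ω * wordWt lam W := by
  obtain ⟨hvalid, ⟨R, -, hfollows⟩, hprefix⟩ := hX
  rw [sum_eq_sum_preimage Walk.mk Walk.mk_injective (fun _ _ _ _ h => (Walk.mk.inj h).1) X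
    (fun τ _ => ⟨τ.start, τ.steps, rfl⟩)]
  have htree (σ : Ω) : StepTree S σ (fun l => R ⟨σ, l⟩)
      (X.preimage (Walk.mk σ) (Walk.mk_injective σ).injOn) :=
    { valid := fun l hl => hvalid ⟨σ, l⟩ (by simpa using hl)
      follows := fun l hl => hfollows ⟨σ, l⟩ (by simpa using hl)
      prefixFree := fun l hl l' hl' h => Walk.mk_injective σ
        (hprefix ⟨σ, l⟩ (by simpa using hl) ⟨σ, l'⟩ (by simpa using hl') ⟨rfl, h⟩).symm }
  calc ∑ σ, ∑ l ∈ X.preimage (Walk.mk σ) (Walk.mk_injective σ).injOn,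
        Walk.wt ωinit S.ρ ⟨σ, l⟩
      ≤ ∑ σ, ωinit σ * pathWt S W σ := by
        refine Finset.sum_le_sum fun σ _ => ?_
        simp only [Walk.wt]
        rw [← Finset.mul_sum]
        refine mul_le_mul_of_nonneg_left ((htree σ).sum_le_pathWt fun l hl => ?_) (hinit.1 σ)
        exact hpre ⟨σ, l⟩ (by simpa using hl)
    _ ≤ ∑ σ, gammaInit ωinit ω * ω σ * pathWt S W σ :=
        Finset.sum_le_sum fun σ _ =>
          mul_le_mul_of_nonneg_right (le_gammaInit_mul hω.1 σ) (pathWt_nonneg W σ)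
    _ = gammaInit ωinit ω * ∑ σ, ω σ * pathWt S W σ := by
        simp only [Finset.mul_sum, mul_assoc]
    _ ≤ gammaInit ωinit ω * wordWt lam W :=
        mul_le_mul_of_nonneg_left (sum_mul_pathWt_le hω hA W) (gammaInit_nonneg hω.1 hinit.1)

end LLLFormal
end
end

section
/- Assume ρ is atomic and (ρ,∼) is weakly commutative. Then for every deterministic strategy Λ and every integer t ≥ 0, there exists a set Bad_π(t) of π-stable walks and a bijection Φ : Bad(t) → Bad_π(t) such that Φ(τ) ≡ τ (i.e., Φ(τ) is obtained from τ by a finite sequence of valid swaps) for every τ ∈ Bad(t). -/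
open scoped Classical

noncomputable section

namespace LLLFormal

section Words

variable {F : Type*} {sim : F → F → Prop}

/-- Equivalence of words under finitely many valid swaps. -/
def WordEquiv (sim : F → F → Prop) : List F → List F → Prop :=
  Relation.ReflTransGen (WordSwap sim)

theorem WordSwap.symm (hsym : Symmetric sim) {W W' : List F} (h : WordSwap sim W W') :
    WordSwap sim W' W := by
  obtain ⟨A, B, f, g, hne, hfg, rfl, rfl⟩ := h
  exact ⟨A, B, g, f, hne.symm, fun h => hfg (hsym h), rfl, rfl⟩

theorem WordEquiv.symm (hsym : Symmetric sim) {W W' : List F} (h : WordEquiv sim W W') :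
    WordEquiv sim W' W := by
  induction h with
  | refl => exact .refl
  | tail _ h ih => exact .head (h.symm hsym) ih

theorem WordSwap.append_left (A : List F) {W W' : List F} (h : WordSwap sim W W') :
    WordSwap sim (A ++ W) (A ++ W') := by
  obtain ⟨A', B, f, g, hne, hfg, rfl, rfl⟩ := h
  exact ⟨A ++ A', B, f, g, hne, hfg, by simp, by simp⟩

theorem WordSwap.append_right (B : List F) {W W' : List F} (h : WordSwap sim W W') :
    WordSwap sim (W ++ B) (W' ++ B) := by
  obtain ⟨A, B', f, g, hne, hfg, rfl, rfl⟩ := h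
  exact ⟨A, B' ++ B, f, g, hne, hfg, by simp, by simp⟩

theorem WordEquiv.append_left (A : List F) {W W' : List F} (h : WordEquiv sim W W') :
    WordEquiv sim (A ++ W) (A ++ W') :=
  Relation.ReflTransGen.lift (A ++ ·) (fun _ _ h => h.append_left A) _ _ h

theorem WordEquiv.append_right (B : List F) {W W' : List F} (h : WordEquiv sim W W') :
    WordEquiv sim (W ++ B) (W' ++ B) :=
  Relation.ReflTransGen.lift (· ++ B) (fun _ _ h => h.append_right B) _ _ h

theorem WordSwap.erase (a : F) {W W' : List F} (h : WordSwap sim W W') :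
    WordEquiv sim (W.erase a) (W'.erase a) := by
  obtain ⟨A, B, f, g, hne, hfg, rfl, rfl⟩ := h
  by_cases ha : a ∈ A
  · rw [List.erase_append_left _ ha, List.erase_append_left _ ha]
    exact .single ⟨_, B, f, g, hne, hfg, rfl, rfl⟩
  · rw [List.erase_append_right _ ha, List.erase_append_right _ ha]
    by_cases hf : f = a
    · subst hf
      simp only [List.erase_cons_head, List.erase_cons_tail (b := g) (by simpa using hne.symm)]
      exact .refl
    by_cases hg : g = a
    · subst hg
      simp only [List.erase_cons_head, List.erase_cons_tail (b := f) (by simpa using hf)]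
      exact .refl
    · simp only [List.erase_cons_tail (b := g) (a := a) (by simpa using hg),
        List.erase_cons_tail (b := f) (a := a) (by simpa using hf)]
      exact .single ⟨A, _, f, g, hne, hfg, rfl, rfl⟩

theorem WordEquiv.erase (a : F) {W W' : List F} (h : WordEquiv sim W W') :
    WordEquiv sim (W.erase a) (W'.erase a) := by
  induction h with
  | refl => exact .refl
  | tail _ h ih => exact Relation.ReflTransGen.trans ih (h.erase a)

theorem WordEquiv.of_cons {a : F} {W W' : List F} (h : WordEquiv sim (a :: W) (a :: W')) :
    WordEquiv sim W W' := by
  simpa using h.erase a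

theorem wordEquiv_append_singleton {g : F} {L : List F}
    (h : ∀ x ∈ L, ¬ (x = g ∨ sim x g)) : WordEquiv sim (L ++ [g]) (g :: L) := by
  induction L with
  | nil => exact .refl
  | cons a L ih =>
    have ha := h a (by simp)
    rw [not_or] at ha
    refine Relation.ReflTransGen.tail
      ((ih fun x hx => h x (List.mem_cons_of_mem _ hx)).append_left [a]) ?_
    exact ⟨[], L, a, g, ha.1, ha.2, rfl, rfl⟩

variable [LinearOrder F]

theorem exists_split_of_pairwise_lt {g : F} {b : List F} (hb : b.Pairwise (· < ·))
    (hg : g ∉ b) : ∃ L R, b = L ++ R ∧ (∀ x ∈ L, x < g) ∧ ∀ x ∈ R, g < x := by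
  induction b with
  | nil => exact ⟨[], [], by simp⟩
  | cons a b ih =>
    rw [List.pairwise_cons] at hb
    simp only [List.mem_cons, not_or] at hg
    rcases lt_or_gt_of_ne hg.1 with h | h
    · refine ⟨[], a :: b, rfl, by simp, ?_⟩
      intro x hx
      rcases List.mem_cons.1 hx with rfl | hx
      · exact h
      · exact h.trans (hb.1 x hx)
    · obtain ⟨L, R, rfl, hL, hR⟩ := ih hb.2 hg.2
      exact ⟨a :: L, R, rfl, by simpa using ⟨h, hL⟩, hR⟩

/-- Every flaw of the block `b'` lies in `Γ⁺` of the block `b`. -/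
def BlockLink (sim : F → F → Prop) (b b' : List F) : Prop :=
  ∀ g ∈ b', ∃ f ∈ b, f = g ∨ sim f g

/-- A nonempty independent block listed in strictly increasing order. -/
def PiBlock (sim : F → F → Prop) (b : List F) : Prop :=
  b ≠ [] ∧ b.Pairwise (· < ·) ∧ b.Pairwise fun f g => ¬ sim f g

theorem PiBlock.exists_insert (hsym : Symmetric sim) {g : F} {b : List F} (hb : PiBlock sim b)
    (hg : ∀ x ∈ b, ¬ (x = g ∨ sim x g)) :
    ∃ b', PiBlock sim b' ∧ (∀ x, x ∈ b' ↔ x = g ∨ x ∈ b) ∧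
      ∀ T : List F, (∀ x ∈ T, ¬ (x = g ∨ sim x g)) →
        WordEquiv sim (b ++ T ++ [g]) (b' ++ T) := by
  obtain ⟨L, R, rfl, hL, hR⟩ := exists_split_of_pairwise_lt hb.2.1
    (fun h => hg g h (Or.inl rfl))
  refine ⟨L ++ g :: R, ⟨by simp, ?_, ?_⟩, ?_, ?_⟩
  · have := hb.2.1
    simp only [List.pairwise_append, List.pairwise_cons, List.mem_cons, forall_eq_or_imp]
      at this ⊢
    exact ⟨this.1, ⟨hR, this.2.1⟩, fun a ha => ⟨hL a ha, this.2.2 a ha⟩⟩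
  · have := hb.2.2
    simp only [List.pairwise_append, List.pairwise_cons, List.mem_cons, forall_eq_or_imp]
      at this ⊢
    refine ⟨this.1, ⟨fun x hx h => ?_, this.2.1⟩, fun x hx => ⟨fun h => ?_, this.2.2 x hx⟩⟩
    · exact hg x (by simp [hx]) (Or.inr (hsym h))
    · exact hg x (by simp [hx]) (Or.inr h)
  · intro x
    simp only [List.mem_append, List.mem_cons]
    tauto
  · intro T hT
    have : ∀ x ∈ R ++ T, ¬ (x = g ∨ sim x g) := by
      intro x hx
      rcases List.mem_append.1 hx with hx | hx
      · exact hg x (by simp [hx])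
      · exact hT x hx
    simpa using (wordEquiv_append_singleton this).append_left L

theorem exists_piBlocks_append_singleton (hsym : Symmetric sim) (g : F) (B : List (List F))
    (hB : ∀ b ∈ B, PiBlock sim b) (hc : B.IsChain (BlockLink sim)) :
    ∃ B' : List (List F), (∀ b ∈ B', PiBlock sim b) ∧ B'.IsChain (BlockLink sim) ∧
      WordEquiv sim (B.flatten ++ [g]) B'.flatten ∧
      ∀ b, (b :: B).IsChain (BlockLink sim) → (∃ x ∈ b ++ B.flatten, x = g ∨ sim x g) →
        (b :: B').IsChain (BlockLink sim) := by
  induction B with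
  | nil =>
    refine ⟨[[g]], by simp [PiBlock], by simp, .refl, fun b _ h => ?_⟩
    simpa [BlockLink] using h
  | cons c B ih =>
    by_cases hdep : ∃ x ∈ c ++ B.flatten, x = g ∨ sim x g
    · obtain ⟨B', h1, h2, h3, h4⟩ := ih (fun b hb => hB b (by simp [hb])) hc.tail
      have hcB' := h4 c hc hdep
      refine ⟨c :: B', ?_, hcB', ?_, fun b hb _ => ?_⟩
      · simpa using ⟨hB c (by simp), h1⟩
      · simpa using h3.append_left c
      · rw [List.isChain_cons_cons] at hb ⊢
        exact ⟨hb.1, hcB'⟩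
    · push Not at hdep
      obtain ⟨c', h1, h2, h3⟩ := (hB c (by simp)).exists_insert hsym
        (g := g) (fun x hx => by simpa using hdep x (by simp [hx]))
      have hlink : ∀ d, BlockLink sim c d → BlockLink sim c' d := fun d hd y hy => by
        obtain ⟨f, hf, h⟩ := hd y hy
        exact ⟨f, (h2 f).2 (Or.inr hf), h⟩
      have hchain : (c' :: B).IsChain (BlockLink sim) := by
        cases B with
        | nil => simp
        | cons d B =>
          rw [List.isChain_cons_cons] at hc ⊢
          exact ⟨hlink d hc.1, hc.2⟩
      refine ⟨c' :: B, ?_, hchain, ?_, fun b hb hx => ?_⟩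
      · simp only [List.mem_cons, forall_eq_or_imp]
        exact ⟨h1, fun b hb => hB b (by simp [hb])⟩
      · have := h3 B.flatten fun x hx => by
          simpa using hdep x (List.mem_append_right _ hx)
        simpa using this
      · rw [List.isChain_cons_cons] at hb ⊢
        refine ⟨fun y hy => ?_, hchain⟩
        rcases (h2 y).1 hy with rfl | hy
        · obtain ⟨x, hx, hxy⟩ := hx
          rcases List.mem_append.1 hx with hx | hx
          · exact ⟨x, hx, hxy⟩
          · have := hdep x (by simpa using hx)
            tauto
        · exact hb.1 y hy

theorem exists_piBlocks (hsym : Symmetric sim) (W : List F) :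
    ∃ B : List (List F), (∀ b ∈ B, PiBlock sim b) ∧ B.IsChain (BlockLink sim) ∧
      WordEquiv sim W B.flatten := by
  induction W using List.reverseRecOn with
  | nil => exact ⟨[], by simp, by simp, .refl⟩
  | append_singleton W g ih =>
    obtain ⟨B, h1, h2, h3⟩ := ih
    obtain ⟨B', h1', h2', h3', -⟩ := exists_piBlocks_append_singleton hsym g B h1 h2
    exact ⟨B', h1', h2', Relation.ReflTransGen.trans (h3.append_right [g]) h3'⟩

theorem exists_piStableWord (hsym : Symmetric sim) (W : List F) :
    ∃ W', PiStableWord sim W' ∧ WordEquiv sim W W' := by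
  obtain ⟨B, h1, h2, h3⟩ := exists_piBlocks hsym W
  refine ⟨B.flatten, ⟨B, ⟨rfl, fun b hb => ⟨(h1 b hb).1, ?_, (h1 b hb).2.2⟩, h2⟩,
    fun b hb => (h1 b hb).2.1.isChain⟩, h3⟩
  exact (h1 b hb).2.1.imp fun h => h.ne

end Words

section Walks

variable {Ω F : Type*}

@[simp]
theorem endOf_nil (σ : Ω) : endOf σ ([] : List (F × Ω)) = σ := rfl

@[simp]
theorem endOf_cons (σ : Ω) (p : F × Ω) (l : List (F × Ω)) :
    endOf σ (p :: l) = endOf p.2 l := by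
  cases l <;> simp [endOf, List.getLastD]

@[simp]
theorem endOf_append (σ : Ω) (l l' : List (F × Ω)) :
    endOf σ (l ++ l') = endOf (endOf σ l) l' := by
  induction l generalizing σ with
  | nil => simp
  | cons p l ih => simp [ih]

theorem validFrom_append {step : F → Ω → Ω → Prop} {σ : Ω} {l l' : List (F × Ω)} :
    ValidFrom step σ (l ++ l') ↔ ValidFrom step σ l ∧ ValidFrom step (endOf σ l) l' := by
  induction l generalizing σ with
  | nil => simp [ValidFrom]
  | cons p l ih => simp [ValidFrom, ih, and_assoc]

/-- Following a strategy after the first step amounts to following the shifted strategy. -/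
theorem Follows.of_cons {Λ : Walk Ω F → F} {σ : Ω} {p : F × Ω} {l : List (F × Ω)}
    (h : Follows Λ ⟨σ, p :: l⟩) :
    p.1 = Λ ⟨σ, []⟩ ∧ Follows (fun w => Λ ⟨σ, p :: w.steps⟩) ⟨p.2, l⟩ :=
  ⟨by simpa using h 0 (by simp),
    fun i hi => by simpa using h (i + 1) (by simpa using hi)⟩

variable [Fintype Ω] {S : Setup Ω F} {sim : F → F → Prop}
  {swap : Ω → F → Ω → F → Ω → Ω}

/-- Under atomicity a walk is determined by its word and its final state. -/
theorem Atomic.walk_ext (h : Atomic S) {σ σ' : Ω} {l l' : List (F × Ω)}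
    (hl : ValidFrom S.step σ l) (hl' : ValidFrom S.step σ' l')
    (hw : l.map Prod.fst = l'.map Prod.fst) (he : endOf σ l = endOf σ' l') :
    σ = σ' ∧ l = l' := by
  induction l generalizing σ σ' l' with
  | nil =>
    obtain rfl : l' = [] := by simpa using hw.symm
    exact ⟨he, rfl⟩
  | cons p l ih =>
    rcases l' with - | ⟨p', l'⟩
    · simp at hw
    obtain ⟨f, τ⟩ := p
    obtain ⟨f', τ'⟩ := p'
    simp only [List.map_cons, List.cons.injEq] at hw
    obtain ⟨rfl, hw⟩ := hw
    obtain ⟨rfl, rfl⟩ := ih hl.2 hl'.2 hw (by simpa using he)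
    exact ⟨h f _ _ _ hl.1 hl'.1, rfl⟩

theorem WordSwap.exists_swapStep (hsv : SwapValid S sim swap) {τ : Walk Ω F}
    (hτ : τ.Valid S.step) {W : List F} (h : WordSwap sim τ.word W) :
    ∃ τ', SwapStep S sim swap τ τ' ∧ τ'.Valid S.step ∧ τ'.word = W ∧
      τ'.start = τ.start ∧ τ'.final = τ.final := by
  obtain ⟨A, B, f, g, hne, hfg, hW, rfl⟩ := h
  obtain ⟨σ, l⟩ := τ
  obtain ⟨lA, l', rfl, rfl, hl'⟩ := List.map_eq_append_iff.1 hW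
  obtain ⟨⟨f', σ₂⟩, l'', rfl, rfl, hl''⟩ := List.map_eq_cons_iff.1 hl'
  obtain ⟨⟨g', σ₃⟩, lB, rfl, rfl, rfl⟩ := List.map_eq_cons_iff.1 hl''
  obtain ⟨hA, h1, h2, hB⟩ := validFrom_append.1 hτ
  obtain ⟨h1', h2'⟩ := hsv _ _ _ _ _ h1 h2 hfg
  refine ⟨⟨σ, _⟩, ⟨lA, lB, f', g', σ₂, σ₃, hne, hfg, h1, h2, rfl, rfl⟩, ?_, ?_, rfl, ?_⟩
  · exact validFrom_append.2 ⟨hA, h1', h2', hB⟩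
  · simp [Walk.word]
  · simp [Walk.final]

theorem WordEquiv.exists_swapSteps (hsv : SwapValid S sim swap) {τ : Walk Ω F}
    (hτ : τ.Valid S.step) {W : List F} (h : WordEquiv sim τ.word W) :
    ∃ τ', Relation.ReflTransGen (SwapStep S sim swap) τ τ' ∧ τ'.Valid S.step ∧ τ'.word = W ∧
      τ'.start = τ.start ∧ τ'.final = τ.final := by
  induction h with
  | refl => exact ⟨τ, .refl, hτ, rfl, rfl, rfl⟩
  | tail _ h ih =>
    obtain ⟨τ', h1, h2, rfl, h4, h5⟩ := ih
    obtain ⟨τ'', k1, k2, k3, k4, k5⟩ := h.exists_swapStep hsv h2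
    exact ⟨τ'', h1.tail k1, k2, k3, k4.trans h4, k5.trans h5⟩

/-- Walks following a common strategy, with the same endpoints and equivalent words, coincide. -/
theorem Follows.steps_unique (hatomic : Atomic S) (hsv : SwapValid S sim swap)
    {Λ : Walk Ω F → F} {σ : Ω} {l l' : List (F × Ω)}
    (hl : ValidFrom S.step σ l) (hl' : ValidFrom S.step σ l')
    (hlen : l.length = l'.length) (hf : Follows Λ ⟨σ, l⟩) (hf' : Follows Λ ⟨σ, l'⟩)
    (hw : WordEquiv sim (l.map Prod.fst) (l'.map Prod.fst)) (he : endOf σ l = endOf σ l') :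
    l = l' := by
  induction l generalizing σ l' Λ with
  | nil => exact (List.length_eq_zero_iff.1 hlen.symm).symm
  | cons p l ih =>
    rcases l' with - | ⟨p', l'⟩
    · simp at hlen
    obtain ⟨f, τ⟩ := p
    obtain ⟨f', τ'⟩ := p'
    obtain ⟨hp, hf⟩ := hf.of_cons
    obtain ⟨hp', hf'⟩ := hf'.of_cons
    obtain rfl : f = f' := hp.trans hp'.symm
    replace hw : WordEquiv sim (l.map Prod.fst) (l'.map Prod.fst) := WordEquiv.of_cons hw
    simp only [endOf_cons] at he
    obtain ⟨τ₂, -, h2, h3, h4, h5⟩ := WordEquiv.exists_swapSteps hsv (τ := ⟨τ, l⟩) hl.2 hw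
    obtain rfl : τ = τ' := h4.symm.trans
      (hatomic.walk_ext h2 hl'.2 h3 (h5.trans he)).1
    rw [ih hl.2 hl'.2 (by simpa using hlen) hf hf' hw he]

end Walks

/-- Theorem "Lambda": if `ρ` is atomic and `(ρ,∼)` is weakly commutative
(witnessed by `swap`), then for every deterministic strategy and every `t` there is a set
`Bad_π(t)` of π-stable walks and a bijection `Φ : Bad(t) → Bad_π(t)` such that `Φ τ` is
obtained from `τ` by a finite sequence of valid swaps. -/
theorem stmt_10 {Ω F : Type*} [Fintype Ω] [LinearOrder F]
    (S : Setup Ω F) (sim : F → F → Prop) (hsym : Symmetric sim)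
    (hatomic : Atomic S)
    (swap : Ω → F → Ω → F → Ω → Ω)
    (hsv : SwapValid S sim swap) (hsi : SwapInj S sim swap)
    (ωinit : Ω → ℝ) (Λ : Walk Ω F → F) (hΛ : IsStrategy S Λ) (t : ℕ) :
    ∃ (Bπ : Set (Walk Ω F)) (Φ : Walk Ω F → Walk Ω F),
      (∀ τ' ∈ Bπ, PiStableWord sim (Walk.word τ')) ∧
      Set.BijOn Φ (Bad S Λ ωinit t) Bπ ∧
      ∀ τ ∈ Bad S Λ ωinit t, Relation.ReflTransGen (SwapStep S sim swap) τ (Φ τ) := by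
  have key : ∀ τ : Walk Ω F, ∃ τ' : Walk Ω F, τ.Valid S.step →
      PiStableWord sim τ'.word ∧ Relation.ReflTransGen (SwapStep S sim swap) τ τ' ∧
      WordEquiv sim τ.word τ'.word ∧ τ'.start = τ.start ∧ τ'.final = τ.final := by
    intro τ
    by_cases hτ : τ.Valid S.step
    · obtain ⟨W, hW, hτW⟩ := exists_piStableWord hsym τ.word
      obtain ⟨τ', h1, -, rfl, h4, h5⟩ := hτW.exists_swapSteps hsv hτ
      exact ⟨τ', fun _ => ⟨hW, h1, hτW, h4, h5⟩⟩
    · exact ⟨τ, fun h => absurd h hτ⟩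
  choose Φ hΦ using key
  refine ⟨Φ '' Bad S Λ ωinit t, Φ, ?_, Set.InjOn.bijOn_image ?_, fun τ hτ => (hΦ τ hτ.1).2.1⟩
  · rintro _ ⟨τ, hτ, rfl⟩
    exact (hΦ τ hτ.1).1
  · rintro ⟨σ, l⟩ ⟨hv, hlen, hf, -⟩ ⟨σ', l'⟩ ⟨hv', hlen', hf', -⟩ heq
    obtain ⟨-, -, hw, hs, he⟩ := hΦ _ hv
    obtain ⟨-, -, hw', hs', he'⟩ := hΦ _ hv'
    rw [heq] at hw hs he
    obtain rfl : σ = σ' := hs.symm.trans hs'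
    exact congrArg (Walk.mk σ) (Follows.steps_unique hatomic hsv hv hv' (hlen.trans hlen'.symm)
      hf hf' (Relation.ReflTransGen.trans hw (hw'.symm hsym)) (he.symm.trans he'))

end LLLFormal
end
end
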